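/- arXiv:0804.0845 — 6 statements merged into one kernel-verified Lean document; each statement's English description precedes it below -/
import Mathlib

section
/- Let g : [0,∞) → [0,∞) be a convex function with g(0) = 0, let A₁,…,A_m be positive semidefinite n×n complex matrices, and let Z₁,…,Z_m be expansive n×n complex matrices (i.e. Zᵢ*Zᵢ ≥ I). Then for every k with 1 ≤ k ≤ n, the sum of the k largest eigenvalues of ∑ᵢ Zᵢ*g(Aᵢ)Zᵢ is at most the sum of the k largest eigenvalues of g(∑ᵢ Zᵢ*AᵢZᵢ). -/
open Matrix ComplexOrder

/-- `f(A)` for a Hermitian matrix `A`: apply `f` to the eigenvalues in a spectral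
decomposition of `A`. -/
noncomputable def matFn {n : ℕ} (f : ℝ → ℝ) (A : Matrix (Fin n) (Fin n) ℂ)
    (hA : A.IsHermitian) : Matrix (Fin n) (Fin n) ℂ :=
  (hA.eigenvectorUnitary : Matrix (Fin n) (Fin n) ℂ) *
    Matrix.diagonal (fun i => (f (hA.eigenvalues i) : ℂ)) *
    (star hA.eigenvectorUnitary : Matrix (Fin n) (Fin n) ℂ)

theorem matFn_isHermitian {n : ℕ} (f : ℝ → ℝ) (A : Matrix (Fin n) (Fin n) ℂ)
    (hA : A.IsHermitian) : (matFn f A hA).IsHermitian := by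
  have h1 : (Matrix.diagonal (fun i => (f (hA.eigenvalues i) : ℂ))).IsHermitian :=
    Matrix.isHermitian_diagonal_of_self_adjoint _ (by ext i; simp [Pi.star_def])
  have h2 := Matrix.isHermitian_mul_mul_conjTranspose
    (hA.eigenvectorUnitary : Matrix (Fin n) (Fin n) ℂ) h1
  simpa [matFn, Matrix.star_eq_conjTranspose] using h2

/-- The sum of the `k` largest entries of `μ` (for the eigenvalue vector of a Hermitian
matrix, this is the Ky Fan `k`-sum of its eigenvalues). -/
noncomputable def sumKLargest {n : ℕ} (μ : Fin n → ℝ) (k : ℕ) : ℝ :=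
  (((List.ofFn μ).insertionSort (· ≥ ·)).take k).sum

theorem isHermitian_sum_conj {n m : ℕ} (A Z : Fin m → Matrix (Fin n) (Fin n) ℂ)
    (hA : ∀ i, (A i).IsHermitian) : (∑ i, (Z i)ᴴ * A i * Z i).IsHermitian := by
  rw [Matrix.IsHermitian, Matrix.conjTranspose_sum]
  exact Finset.sum_congr rfl fun i _ =>
    Matrix.isHermitian_conjTranspose_mul_mul (Z i) (hA i)

section Convex
variable {g : ℝ → ℝ}

theorem ConvexOn.mul_apply_le_of_apply_zero (hg : ConvexOn ℝ (Set.Ici 0) g) (hg00 : g 0 = 0)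
    {x y : ℝ} (hx : 0 ≤ x) (hxy : x ≤ y) : y * g x ≤ x * g y := by
  rcases hx.eq_or_lt with rfl | hx
  · simp [hg00]
  have hy := hx.trans_le hxy
  have h := hg.2 (Set.self_mem_Ici (a := (0 : ℝ))) (Set.mem_Ici.2 hy.le)
    (sub_nonneg.2 ((div_le_one hy).2 hxy)) (div_nonneg hx.le hy.le) (sub_add_cancel 1 (x / y))
  simp only [smul_eq_mul, mul_zero, hg00, zero_add, div_mul_cancel₀ _ hy.ne'] at h
  calc y * g x ≤ y * (x / y * g y) := by gcongr
    _ = x * g y := by field_simp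

theorem ConvexOn.le_of_apply_le (hg : ConvexOn ℝ (Set.Ici 0) g) (hg00 : g 0 = 0) {x y : ℝ}
    (hy : 0 ≤ y) (hgx : 0 < g x) (h : g x ≤ g y) : x ≤ y := by
  by_contra! hlt
  nlinarith [hg.mul_apply_le_of_apply_zero hg00 hy hlt.le]

theorem ConvexOn.div_apply_le_div_apply (hg : ConvexOn ℝ (Set.Ici 0) g) (hg00 : g 0 = 0)
    {x y : ℝ} (hx : 0 ≤ x) (hy : 0 ≤ y) (hgx : 0 < g x) (h : g x ≤ g y) :
    y / g y ≤ x / g x := by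
  rw [div_le_div_iff₀ (hgx.trans_le h) hgx]
  exact hg.mul_apply_le_of_apply_zero hg00 hx (hg.le_of_apply_le hg00 hy hgx h)

theorem ConvexOn.exists_subgradient (hg : ConvexOn ℝ (Set.Ici 0) g) {a : ℝ} (ha : 0 < a) :
    ∃ c, ∀ x, 0 ≤ x → g a + c * (x - a) ≤ g x := by
  have hai : a ∈ interior (Set.Ici (0 : ℝ)) := by simpa using ha
  refine ⟨derivWithin g (Set.Ioi a) a, fun x hx => ?_⟩
  rcases lt_trichotomy x a with h | rfl | h
  · have h1 := (hg.slope_le_leftDeriv_of_mem_interior hx hai h).trans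
      (hg.leftDeriv_le_rightDeriv_of_mem_interior hai)
    rw [slope_def_field, div_le_iff₀ (by linarith)] at h1
    linarith
  · simp
  · have h1 := hg.rightDeriv_le_slope_of_mem_interior hai hx h
    rw [slope_def_field, le_div_iff₀ (by linarith)] at h1
    linarith

theorem ConvexOn.exists_pos_apply_eq (hg : ConvexOn ℝ (Set.Ici 0) g) (hg00 : g 0 = 0)
    {a μ : ℝ} (ha : 0 ≤ a) (hga : 0 < g a) (hμ : 0 < μ) : ∃ x, 0 < x ∧ g x = μ := by
  have ha : 0 < a := ha.lt_of_ne (by rintro rfl; simp [hg00] at hga)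
  set s := min 1 (μ / g a) with hs
  set t := max 1 (μ / g a) with ht
  have hs0 : 0 < s := by positivity
  have hst : s ≤ t := (min_le_left _ _).trans (le_max_left _ _)
  have ht0 : 0 < t := hs0.trans_le hst
  have h1 : g (s * a) ≤ μ := by
    have := hg.mul_apply_le_of_apply_zero hg00 (x := s * a) (y := a) (by positivity)
      (mul_le_of_le_one_left ha.le (min_le_left _ _))
    have h2 : s * g a ≤ μ := by rw [← le_div_iff₀ hga]; exact min_le_right _ _
    nlinarith
  have h2 : μ ≤ g (t * a) := by
    have := hg.mul_apply_le_of_apply_zero hg00 (x := a) (y := t * a) ha.le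
      (le_mul_of_one_le_left ha.le (le_max_left _ _))
    have h2 : μ ≤ t * g a := by rw [← div_le_iff₀ hga]; exact le_max_right _ _
    nlinarith
  have hcont : ContinuousOn g (Set.Icc (s * a) (t * a)) :=
    hg.continuousOn_interior.mono fun x hx => by
      simpa using (mul_pos hs0 ha).trans_le hx.1
  obtain ⟨x, hx, rfl⟩ := intermediate_value_Icc (by gcongr) hcont ⟨h1, h2⟩
  exact ⟨x, (mul_pos hs0 ha).trans_le hx.1, rfl⟩

end Convex

section Weights
variable {ι κ : Type*} [Fintype ι] [Fintype κ]

theorem sum_mul_sum_le_sum_mul_sum_of_monovary (w c d : κ → ℝ) (hw : ∀ j, 0 ≤ w j)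
    (h : ∀ j l, 0 < w j → 0 < w l → 0 ≤ (c j - c l) * (d j - d l)) :
    (∑ j, w j * c j) * (∑ j, w j * d j) ≤ (∑ j, w j) * ∑ j, w j * (c j * d j) := by
  have hnn : 0 ≤ ∑ j, ∑ l, w j * w l * ((c j - c l) * (d j - d l)) :=
    Finset.sum_nonneg fun j _ => Finset.sum_nonneg fun l _ => by
      rcases (hw j).eq_or_lt with hj | hj
      · simp [← hj]
      rcases (hw l).eq_or_lt with hl | hl
      · simp [← hl]
      exact mul_nonneg (mul_nonneg hj.le hl.le) (h j l hj hl)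
  have heq : ∑ j, ∑ l, w j * w l * ((c j - c l) * (d j - d l)) =
      2 * ((∑ j, w j) * ∑ j, w j * (c j * d j)) -
        2 * ((∑ j, w j * c j) * (∑ j, w j * d j)) := by
    have e : ∀ j l, w j * w l * ((c j - c l) * (d j - d l)) =
        w j * (w l * (c l * d l)) + w j * (c j * d j) * w l
          - w j * c j * (w l * d l) - w j * d j * (w l * c l) := fun j l => by ring
    simp only [e, Finset.sum_sub_distrib, Finset.sum_add_distrib, ← Finset.mul_sum,
      ← Finset.sum_mul]
    ring
  linarith

theorem sum_mul_nonneg_of_monovary (w c d : κ → ℝ) (hw : ∀ j, 0 ≤ w j) (hc : ∀ j, 0 ≤ c j)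
    (h : ∀ j l, 0 < w j → 0 < w l → 0 ≤ (c j - c l) * (d j - d l))
    (hW : 0 < ∑ j, w j) (hd : 0 ≤ ∑ j, w j * d j) : 0 ≤ ∑ j, w j * (c j * d j) := by
  have h1 := sum_mul_sum_le_sum_mul_sum_of_monovary w c d hw h
  have h2 : 0 ≤ (∑ j, w j * c j) * ∑ j, w j * d j :=
    mul_nonneg (Finset.sum_nonneg fun j _ => mul_nonneg (hw j) (hc j)) hd
  exact nonneg_of_mul_nonneg_right (h2.trans h1) hW

variable {g : ℝ → ℝ}

/-- Jensen's inequality for the concave function `u ↦ u * g⁻¹ (1 / u)`. -/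
theorem ConvexOn.sum_mul_div_le (hg : ConvexOn ℝ (Set.Ici 0) g) (hg00 : g 0 = 0)
    {a : ℝ} (ha : 0 ≤ a) (hga : 0 < g a) (w f μ : κ → ℝ) (hw : ∀ j, 0 ≤ w j)
    (hf : ∀ j, 0 ≤ f j) (hgf : ∀ j, g (f j) = μ j) (hμ : ∀ j, 0 < w j → 0 < μ j)
    (hW : 1 ≤ ∑ j, w j) (hinv : g a * ∑ j, w j / μ j ≤ 1) :
    ∑ j, w j * (f j / μ j) ≤ (∑ j, w j) * (a / g a) := by
  have ha : 0 < a := ha.lt_of_ne (by rintro rfl; simp [hg00] at hga)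
  obtain ⟨c, hc⟩ := hg.exists_subgradient ha
  have hca : g a ≤ c * a := by have := hc 0 le_rfl; rw [hg00] at this; linarith
  have hc0 : 0 < c := pos_of_mul_pos_left (hga.trans_le hca) ha.le
  have h1 : c * ∑ j, w j * (f j / μ j) ≤ ∑ j, w j + (c * a - g a) * ∑ j, w j / μ j := by
    rw [Finset.mul_sum, Finset.mul_sum, ← Finset.sum_add_distrib]
    refine Finset.sum_le_sum fun j _ => ?_
    rcases (hw j).eq_or_lt with hj | hj
    · simp [← hj]
    have hμj := hμ j hj
    have h2 := hc (f j) (hf j)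
    rw [hgf] at h2
    have h3 : w j / μ j * (c * f j) ≤ w j / μ j * (μ j + (c * a - g a)) := by
      gcongr; linarith
    calc _ = w j / μ j * (c * f j) := by ring
      _ ≤ _ := h3
      _ = _ := by field_simp
  have h2 : ∑ j, w j / μ j ≤ (∑ j, w j) / g a := by
    rw [le_div_iff₀ hga]; linarith
  have h3 : (c * a - g a) * ∑ j, w j / μ j ≤ (c * a - g a) * ((∑ j, w j) / g a) :=
    mul_le_mul_of_nonneg_left h2 (by linarith)
  refine le_of_mul_le_mul_left (h1.trans ?_) hc0
  calc _ ≤ _ := add_le_add_right h3 _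
    _ = _ := by field_simp; ring

theorem ConvexOn.sum_le_sum_apply_sum (hg : ConvexOn ℝ (Set.Ici 0) g)
    (hg0 : ∀ x ∈ Set.Ici (0 : ℝ), 0 ≤ g x) (hg00 : g 0 = 0)
    (J : Finset κ) (μ : κ → ℝ) (α : ι → ℝ) (w : ι → κ → ℝ)
    (hα : ∀ i, 0 ≤ α i) (hw : ∀ i j, 0 ≤ w i j)
    (hμ : ∀ j, μ j = ∑ i, g (α i) * w i j)
    (hJ : ∀ j ∈ J, ∀ l ∉ J, μ l ≤ μ j)
    (hrow : ∀ i, 1 ≤ ∑ j, w i j)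
    (hinv : ∀ i, g (α i) * ∑ j, w i j / μ j ≤ 1) :
    ∑ j ∈ J, μ j ≤ ∑ j ∈ J, g (∑ i, α i * w i j) := by
  classical
  have hgα : ∀ i, 0 ≤ g (α i) := fun i => hg0 _ (hα i)
  have hterm : ∀ i j, 0 ≤ g (α i) * w i j := fun i j => mul_nonneg (hgα i) (hw i j)
  have hμ0 : ∀ j, 0 ≤ μ j := fun j => hμ j ▸ Finset.sum_nonneg fun i _ => hterm i j
  have hμpos : ∀ i j, 0 < g (α i) → 0 < w i j → 0 < μ j := fun i j h1 h2 => by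
    rw [hμ j]
    exact (mul_pos h1 h2).trans_le
      (Finset.single_le_sum (f := fun i => g (α i) * w i j) (fun i _ => hterm i j)
        (Finset.mem_univ i))
  have hex : ∀ m ∈ Set.range μ, ∃ f c : ℝ, 0 ≤ f ∧ 0 ≤ c ∧ g f = m ∧ (m = 0 → c = 0) ∧
      ∀ x, 0 ≤ x → g f + c * (x - f) ≤ g x := by
    rintro _ ⟨j, rfl⟩
    rcases (hμ0 j).eq_or_lt with hj | hj
    · exact ⟨0, 0, le_rfl, le_rfl, by rw [hg00, hj], fun _ => rfl,
        fun x hx => by simpa [hg00] using hg0 x hx⟩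
    obtain ⟨i, -, hi⟩ : ∃ i ∈ Finset.univ, 0 < g (α i) * w i j :=
      Finset.exists_lt_of_sum_lt (f := fun _ => (0 : ℝ)) (by simpa [← hμ j] using hj)
    obtain ⟨f, hf, hgf⟩ := hg.exists_pos_apply_eq hg00 (hα i)
      (pos_of_mul_pos_left hi (hw i j)) hj
    obtain ⟨c, hc⟩ := hg.exists_subgradient hf
    refine ⟨f, c, hf.le, ?_, hgf, fun h => absurd h hj.ne', hc⟩
    have := hc 0 le_rfl
    rw [hg00, hgf] at this
    exact (pos_of_mul_pos_left (hj.trans_le (by linarith)) hf.le).le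
  choose! F C hF hC hgF hC0 hsub using hex
  have hmem : ∀ j, μ j ∈ Set.range μ := fun j => ⟨j, rfl⟩
  set c : κ → ℝ := fun j => if j ∈ J then C (μ j) else 0 with hc
  have hc0 : ∀ j, 0 ≤ c j := fun j => by
    simp only [hc]; split_ifs
    exacts [hC _ (hmem j), le_rfl]
  have hcμ : ∀ j, μ j = 0 → c j = 0 := fun j hj => by
    simp only [hc]; split_ifs
    exacts [hC0 _ (hmem j) hj, rfl]
  have hmono : ∀ j l, 0 < μ l → μ l < μ j →
      c l ≤ c j ∧ F (μ j) / μ j ≤ F (μ l) / μ l := by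
    intro j l hl hlj
    have hgl := hgF _ (hmem l)
    have hgj := hgF _ (hmem j)
    constructor
    · simp only [hc]
      split_ifs with h1 h2 h2
      · have hFl : F (μ l) < F (μ j) := by
          refine lt_of_le_of_ne (hg.le_of_apply_le hg00 (hF _ (hmem j)) ?_ ?_) ?_
          · rwa [hgl]
          · rw [hgl, hgj]; exact hlj.le
          · intro h; rw [← h, hgl] at hgj; exact hlj.ne hgj
        have e1 := hsub _ (hmem l) _ (hF _ (hmem j))
        have e2 := hsub _ (hmem j) _ (hF _ (hmem l))
        nlinarith
      · exact absurd (hJ l h1 j h2) (not_le.2 hlj)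
      · exact hC _ (hmem j)
      · exact le_rfl
    · have := hg.div_apply_le_div_apply hg00 (hF _ (hmem l)) (hF _ (hmem j))
        (by rwa [hgl]) (by rw [hgl, hgj]; exact hlj.le)
      rwa [hgl, hgj] at this
  have key : ∀ i, 0 ≤ ∑ j, w i j * (c j * (α i - g (α i) * (F (μ j) / μ j))) := by
    intro i
    rcases (hgα i).eq_or_lt with hi | hi
    · refine Finset.sum_nonneg fun j _ => ?_
      rw [← hi]
      have := hα i
      have := hw i j
      have := hc0 j
      simp only [zero_mul, sub_zero]
      positivity
    refine sum_mul_nonneg_of_monovary _ _ _ (hw i) hc0 (fun j l hj hl => ?_)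
      (one_pos.trans_le (hrow i)) ?_
    · have e : ∀ x y z : ℝ, (α i - g (α i) * x) - (α i - g (α i) * y) = g (α i) * (y - x) :=
        fun x y _ => by ring
      rw [e _ _ 0, mul_left_comm]
      refine mul_nonneg hi.le ?_
      rcases lt_trichotomy (μ j) (μ l) with h | h | h
      · obtain ⟨h1, h2⟩ := hmono l j (hμpos i j hi hj) h
        exact mul_nonneg_of_nonpos_of_nonpos (by linarith) (by linarith)
      · simp [h]
      · obtain ⟨h1, h2⟩ := hmono j l (hμpos i l hi hl) h
        exact mul_nonneg (by linarith) (by linarith)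
    · have h1 := hg.sum_mul_div_le hg00 (hα i) hi (w i) (fun j => F (μ j)) μ (hw i)
        (fun j => hF _ (hmem j)) (fun j => hgF _ (hmem j)) (fun j => hμpos i j hi) (hrow i)
        (hinv i)
      have h2 : ∑ j, w i j * (α i - g (α i) * (F (μ j) / μ j)) =
          g (α i) * ((∑ j, w i j) * (α i / g (α i)) - ∑ j, w i j * (F (μ j) / μ j)) := by
        rw [mul_sub, Finset.mul_sum, Finset.sum_mul, Finset.mul_sum, ← Finset.sum_sub_distrib]
        refine Finset.sum_congr rfl fun j _ => ?_
        field_simp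
      rw [h2]
      exact mul_nonneg hi.le (by linarith)
  have hsum : 0 ≤ ∑ j, c j * (∑ i, α i * w i j - F (μ j)) := by
    refine (Finset.sum_nonneg (s := Finset.univ) fun i _ => key i).trans_eq ?_
    rw [Finset.sum_comm]
    refine Finset.sum_congr rfl fun j _ => ?_
    rcases (hμ0 j).eq_or_lt with hj | hj
    · simp [hcμ j hj.symm]
    have : F (μ j) = ∑ i, g (α i) * w i j * (F (μ j) / μ j) := by
      rw [← Finset.sum_mul, ← hμ j]; field_simp
    conv_rhs => rw [this]
    rw [← Finset.sum_sub_distrib, Finset.mul_sum]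
    exact Finset.sum_congr rfl fun i _ => by ring
  have hsumJ : 0 ≤ ∑ j ∈ J, C (μ j) * (∑ i, α i * w i j - F (μ j)) := by
    refine hsum.trans_eq ?_
    simp [hc, ite_mul, Finset.sum_ite_mem]
  have hfin : ∑ j ∈ J, (μ j + C (μ j) * (∑ i, α i * w i j - F (μ j))) ≤
      ∑ j ∈ J, g (∑ i, α i * w i j) := by
    refine Finset.sum_le_sum fun j _ => ?_
    have := hsub _ (hmem j) (∑ i, α i * w i j)
      (Finset.sum_nonneg fun i _ => mul_nonneg (hα i) (hw i j))
    rwa [hgF _ (hmem j)] at this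
  rw [Finset.sum_add_distrib] at hfin
  linarith

end Weights

section KyFan

theorem exists_finset_sum_eq_sumKLargest {n : ℕ} (μ : Fin n → ℝ) {k : ℕ} (hk : k ≤ n) :
    ∃ J : Finset (Fin n), J.card = k ∧ (∀ j ∈ J, ∀ l ∉ J, μ l ≤ μ j) ∧
      sumKLargest μ k = ∑ j ∈ J, μ j := by
  set σ := Tuple.sort fun i => -μ i with hσ
  have hanti : Antitone (μ ∘ σ) := fun i j hij =>
    neg_le_neg_iff.1 (Tuple.monotone_sort (fun i => -μ i) hij)
  refine ⟨(Finset.univ.filter fun j : Fin n => j.val < k).map σ.toEmbedding, ?_, ?_, ?_⟩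
  · rw [Finset.card_map, Fin.card_filter_val_lt, min_eq_right hk]
  · intro j hj l hl
    simp only [Finset.mem_map_equiv, Finset.mem_filter, Finset.mem_univ, true_and,
      not_lt] at hj hl
    have := hanti (show σ.symm j ≤ σ.symm l from (hj.trans_le hl).le)
    simpa using this
  · have hsort : (List.ofFn μ).insertionSort (· ≥ ·) = List.ofFn (μ ∘ σ) :=
      ((List.perm_insertionSort _ _).trans (σ.ofFn_comp_perm μ).symm).eq_of_pairwise'
        (List.pairwise_insertionSort _ _) hanti.sortedGE_ofFn.pairwise
    rw [sumKLargest, hsort, List.sum_take_ofFn, Finset.sum_map]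
    rfl

/-- Averages of `ν` along `k` columns of a doubly stochastic matrix do not exceed the sum of
the `k` largest entries of `ν`. -/
theorem sum_sum_mul_le_sumKLargest {n : ℕ} (ν : Fin n → ℝ) (r : Fin n → Fin n → ℝ)
    (hr : ∀ l j, 0 ≤ r l j) (hrow : ∀ l, ∑ j, r l j = 1) (hcol : ∀ j, ∑ l, r l j = 1)
    {J : Finset (Fin n)} {k : ℕ} (hJ : J.card = k) (hk1 : 1 ≤ k) :
    ∑ j ∈ J, ∑ l, ν l * r l j ≤ sumKLargest ν k := by
  classical
  have hkn : k ≤ n := by simpa [hJ] using J.card_le_univ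
  obtain ⟨I, hI, hmax, hsum⟩ := exists_finset_sum_eq_sumKLargest ν hkn
  obtain ⟨i, hiI, hi⟩ := I.exists_min_image ν (Finset.card_pos.1 (by omega))
  have ht1 : ∀ l, ∑ j ∈ J, r l j ≤ 1 := fun l => (hrow l).symm ▸
    Finset.sum_le_sum_of_subset_of_nonneg J.subset_univ fun j _ _ => hr l j
  have ht0 : ∀ l, 0 ≤ ∑ j ∈ J, r l j := fun l => Finset.sum_nonneg fun j _ => hr l j
  have htot : ∑ l, ∑ j ∈ J, r l j = k := by
    rw [Finset.sum_comm, Finset.sum_congr rfl fun j _ => hcol j]; simp [hJ]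
  have hnn : 0 ≤ ∑ l, ((if l ∈ I then 1 else 0) - ∑ j ∈ J, r l j) * (ν l - ν i) := by
    refine Finset.sum_nonneg fun l _ => ?_
    split_ifs with hl
    · exact mul_nonneg (sub_nonneg.2 (ht1 l)) (sub_nonneg.2 (hi l hl))
    · exact mul_nonneg_of_nonpos_of_nonpos (by linarith [ht0 l])
        (sub_nonpos.2 (hmax i hiI l hl))
  have hexp : ∑ l, ((if l ∈ I then 1 else 0) - ∑ j ∈ J, r l j) * (ν l - ν i) =
      ∑ l ∈ I, ν l - ∑ j ∈ J, ∑ l, ν l * r l j := by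
    simp only [mul_sub, sub_mul, Finset.sum_sub_distrib, ← Finset.sum_mul, htot]
    rw [Finset.sum_comm (s := J)]
    simp [hI, ← Finset.mul_sum, mul_comm]
  linarith

end KyFan

section MatFn
variable {n : ℕ}

theorem conjTranspose_mul_diagonal_mul_apply_self {ι κ : Type*} [Fintype ι] [DecidableEq ι]
    (B : Matrix ι κ ℂ) (d : ι → ℝ) (j : κ) :
    (Bᴴ * diagonal (fun l => (d l : ℂ)) * B) j j =
      ((∑ l, d l * Complex.normSq (B l j) : ℝ) : ℂ) := by
  rw [Matrix.mul_apply]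
  push_cast
  refine Finset.sum_congr rfl fun l _ => ?_
  rw [Matrix.mul_diagonal, conjTranspose_apply, Complex.normSq_eq_conj_mul_self]
  simp only [Complex.star_def]
  ring

theorem mul_conjTranspose_apply_self {ι κ : Type*} [Fintype κ] (B : Matrix ι κ ℂ) (l : ι) :
    (B * Bᴴ) l l = ((∑ j, Complex.normSq (B l j) : ℝ) : ℂ) := by
  rw [Matrix.mul_apply]
  push_cast
  exact Finset.sum_congr rfl fun j _ => by
    rw [conjTranspose_apply, Complex.star_def, Complex.mul_conj]

theorem posSemidef_mul_conjTranspose_sub_one {B : Matrix (Fin n) (Fin n) ℂ}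
    (hB : (Bᴴ * B - 1).PosSemidef) : (B * Bᴴ - 1).PosSemidef := by
  have hdet : IsUnit B.det := by
    have h : (Bᴴ * B).PosDef := by
      simpa using PosDef.posSemidef_add hB PosDef.one
    have h := (isUnit_iff_isUnit_det _).1 h.isUnit
    rw [det_mul] at h
    exact isUnit_of_mul_isUnit_right h
  have h1 : B * B⁻¹ = 1 := mul_nonsing_inv B hdet
  have h3 : B⁻¹ᴴ * Bᴴ = 1 := by rw [← conjTranspose_mul, h1, conjTranspose_one]
  set C := B⁻¹
  have hC : (1 - Cᴴ * C).PosSemidef := by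
    convert hB.conjTranspose_mul_mul_same C using 1
    rw [mul_sub, sub_mul, ← Matrix.mul_assoc, h3, Matrix.one_mul, Matrix.mul_one, h1]
  have hC' : (1 - C * Cᴴ).PosSemidef := by
    have e := (posSemidef_conjTranspose_mul_self (1 - C * Cᴴ)).add
      (hC.mul_mul_conjTranspose_same C)
    convert e using 1
    simp only [conjTranspose_sub, conjTranspose_one, conjTranspose_mul,
      conjTranspose_conjTranspose]
    noncomm_ring
  convert hC'.mul_mul_conjTranspose_same B using 1
  rw [mul_sub, sub_mul, Matrix.mul_one, ← Matrix.mul_assoc, h1, Matrix.one_mul, h3]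

theorem one_le_sum_normSq_row {B : Matrix (Fin n) (Fin n) ℂ}
    (hB : (Bᴴ * B - 1).PosSemidef) (l : Fin n) : 1 ≤ ∑ j, Complex.normSq (B l j) := by
  have h := (posSemidef_mul_conjTranspose_sub_one hB).diag_nonneg (i := l)
  rw [Matrix.sub_apply, mul_conjTranspose_apply_self, one_apply_eq, sub_nonneg] at h
  exact_mod_cast h

theorem sum_normSq_row_eq_one {V : Matrix (Fin n) (Fin n) ℂ} (hV : V * Vᴴ = 1) (l : Fin n) :
    ∑ j, Complex.normSq (V l j) = 1 := by
  have h := mul_conjTranspose_apply_self V l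
  rw [hV, one_apply_eq] at h
  exact_mod_cast h.symm

theorem sum_normSq_col_eq_one {V : Matrix (Fin n) (Fin n) ℂ} (hV : Vᴴ * V = 1) (j : Fin n) :
    ∑ l, Complex.normSq (V l j) = 1 := by
  simpa using sum_normSq_row_eq_one (V := Vᴴ) (by simpa using hV) j

theorem matFn_id (A : Matrix (Fin n) (Fin n) ℂ) (hA : A.IsHermitian) :
    matFn (fun x => x) A hA = A := by
  conv_rhs => rw [hA.spectral_theorem, Unitary.conjStarAlgAut_apply]
  rfl

theorem conjTranspose_mul_matFn_mul (f : ℝ → ℝ) (A : Matrix (Fin n) (Fin n) ℂ)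
    (hA : A.IsHermitian) (X : Matrix (Fin n) (Fin n) ℂ) :
    Xᴴ * matFn f A hA * X = ((hA.eigenvectorUnitary : Matrix (Fin n) (Fin n) ℂ)ᴴ * X)ᴴ *
      diagonal (fun l => (f (hA.eigenvalues l) : ℂ)) *
        ((hA.eigenvectorUnitary : Matrix (Fin n) (Fin n) ℂ)ᴴ * X) := by
  simp only [matFn, conjTranspose_mul, conjTranspose_conjTranspose, Matrix.mul_assoc,
    star_eq_conjTranspose]

theorem conjTranspose_mul_mul_eq {A : Matrix (Fin n) (Fin n) ℂ} (hA : A.IsHermitian)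
    (X : Matrix (Fin n) (Fin n) ℂ) :
    Xᴴ * A * X = ((hA.eigenvectorUnitary : Matrix (Fin n) (Fin n) ℂ)ᴴ * X)ᴴ *
      diagonal (fun l => (hA.eigenvalues l : ℂ)) *
        ((hA.eigenvectorUnitary : Matrix (Fin n) (Fin n) ℂ)ᴴ * X) := by
  simpa only [matFn_id] using conjTranspose_mul_matFn_mul (fun x => x) A hA X

theorem eigenvectorUnitary_conjTranspose_mul_self {A : Matrix (Fin n) (Fin n) ℂ}
    (hA : A.IsHermitian) :
    (hA.eigenvectorUnitary : Matrix (Fin n) (Fin n) ℂ)ᴴ *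
      (hA.eigenvectorUnitary : Matrix (Fin n) (Fin n) ℂ) = 1 :=
  Unitary.coe_star_mul_self hA.eigenvectorUnitary

theorem eigenvectorUnitary_mul_conjTranspose_self {A : Matrix (Fin n) (Fin n) ℂ}
    (hA : A.IsHermitian) :
    (hA.eigenvectorUnitary : Matrix (Fin n) (Fin n) ℂ) *
      (hA.eigenvectorUnitary : Matrix (Fin n) (Fin n) ℂ)ᴴ = 1 :=
  Unitary.coe_mul_star_self hA.eigenvectorUnitary

theorem conjTranspose_eigenvectorUnitary_mul_mul {A : Matrix (Fin n) (Fin n) ℂ}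
    (hA : A.IsHermitian) :
    (hA.eigenvectorUnitary : Matrix (Fin n) (Fin n) ℂ)ᴴ * A *
      (hA.eigenvectorUnitary : Matrix (Fin n) (Fin n) ℂ) =
      diagonal fun l => (hA.eigenvalues l : ℂ) := by
  rw [conjTranspose_mul_mul_eq hA, eigenvectorUnitary_conjTranspose_mul_self]
  simp

/-- Jensen and Ky Fan combined: the diagonal of a Hermitian matrix in an orthonormal basis. -/
theorem sum_apply_diag_le_sumKLargest {g : ℝ → ℝ} (hg : ConvexOn ℝ (Set.Ici 0) g)
    {S : Matrix (Fin n) (Fin n) ℂ} (hS : S.PosSemidef) {E : Matrix (Fin n) (Fin n) ℂ}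
    (hE : Eᴴ * E = 1) {J : Finset (Fin n)} {k : ℕ} (hJ : J.card = k) (hk1 : 1 ≤ k) :
    ∑ j ∈ J, g ((Eᴴ * S * E) j j).re ≤
      sumKLargest (matFn_isHermitian g S hS.1).eigenvalues k := by
  have hcol : ∀ {M : Matrix (Fin n) (Fin n) ℂ} (hM : M.IsHermitian),
      ((hM.eigenvectorUnitary : Matrix (Fin n) (Fin n) ℂ)ᴴ * E)ᴴ *
        ((hM.eigenvectorUnitary : Matrix (Fin n) (Fin n) ℂ)ᴴ * E) = 1 := fun hM => by
    rw [conjTranspose_mul, conjTranspose_conjTranspose, Matrix.mul_assoc,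
      ← Matrix.mul_assoc _ _ E, eigenvectorUnitary_mul_conjTranspose_self, Matrix.one_mul, hE]
  set hG := matFn_isHermitian g S hS.1
  refine le_trans (Finset.sum_le_sum fun j _ => ?_)
    (sum_sum_mul_le_sumKLargest hG.eigenvalues
      (fun l j => Complex.normSq (((hG.eigenvectorUnitary : Matrix (Fin n) (Fin n) ℂ)ᴴ * E) l j))
      (fun _ _ => Complex.normSq_nonneg _)
      (sum_normSq_row_eq_one (mul_eq_one_comm.1 (hcol hG)))
      (sum_normSq_col_eq_one (hcol hG)) hJ hk1)
  have h2 := congrArg (fun M => M j j) (conjTranspose_mul_mul_eq hG E)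
  simp only [conjTranspose_mul_matFn_mul, conjTranspose_mul_diagonal_mul_apply_self] at h2
  rw [conjTranspose_mul_mul_eq hS.1, conjTranspose_mul_diagonal_mul_apply_self,
    Complex.ofReal_re, ← Complex.ofReal_inj.1 h2]
  have h3 := hg.map_sum_le (t := Finset.univ) (p := hS.1.eigenvalues)
    (fun l _ => Complex.normSq_nonneg _) (sum_normSq_col_eq_one (hcol hS.1) j)
    (fun l _ => hS.eigenvalues_nonneg l)
  simpa only [smul_eq_mul, mul_comm] using h3

theorem conjTranspose_mul_sum_matFn_mul {m : ℕ} (f : ℝ → ℝ)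
    (A Z : Fin m → Matrix (Fin n) (Fin n) ℂ) (hA : ∀ p, (A p).IsHermitian)
    (X : Matrix (Fin n) (Fin n) ℂ) :
    Xᴴ * (∑ p, (Z p)ᴴ * matFn f (A p) (hA p) * Z p) * X =
      ∑ p, (((hA p).eigenvectorUnitary : Matrix (Fin n) (Fin n) ℂ)ᴴ * (Z p * X))ᴴ *
        diagonal (fun l => (f ((hA p).eigenvalues l) : ℂ)) *
          (((hA p).eigenvectorUnitary : Matrix (Fin n) (Fin n) ℂ)ᴴ * (Z p * X)) := by
  rw [Finset.mul_sum, Finset.sum_mul]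
  refine Finset.sum_congr rfl fun p _ => ?_
  rw [← conjTranspose_mul_matFn_mul, conjTranspose_mul]
  simp only [Matrix.mul_assoc]

/-- If `∑ Bₚ* diag(dₚ) Bₚ = diag(μ)` then each rank one summand is dominated by `diag(μ)`,
which bounds the weighted square norm of the corresponding row. -/
theorem mul_sum_normSq_div_le_one {ι : Type*} [Fintype ι] [DecidableEq ι] (μ : Fin n → ℝ)
    (d : ι → Fin n → ℝ) (hd : ∀ p l, 0 ≤ d p l) (B : ι → Matrix (Fin n) (Fin n) ℂ)
    (h : ∑ p, (B p)ᴴ * diagonal (fun l => (d p l : ℂ)) * B p =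
      diagonal fun j => (μ j : ℂ)) (p : ι) (l : Fin n) :
    d p l * ∑ j, Complex.normSq (B p l j) / μ j ≤ 1 := by
  set q := ∑ j, Complex.normSq (B p l j) / μ j with hq
  set X : Matrix (Fin n) (Fin n) ℂ := diagonal (fun j => ((μ j)⁻¹ : ℂ)) * (B p)ᴴ with hX
  have h1 : (Xᴴ * diagonal (fun j => (μ j : ℂ)) * X) l l = (q : ℂ) := by
    rw [conjTranspose_mul_diagonal_mul_apply_self, hq]
    congr 1
    refine Finset.sum_congr rfl fun j _ => ?_
    rw [hX, diagonal_mul, conjTranspose_apply]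
    simp only [Complex.star_def, map_mul, Complex.normSq_conj, ← Complex.ofReal_inv,
      Complex.normSq_ofReal]
    by_cases hj : μ j = 0
    · simp [hj]
    · field_simp
  have h2 : (B p * X) l l = (q : ℂ) := by
    rw [Matrix.mul_apply, hq]
    push_cast
    refine Finset.sum_congr rfl fun j _ => ?_
    rw [hX, diagonal_mul, conjTranspose_apply, Complex.star_def, Complex.normSq_eq_conj_mul_self]
    ring
  have h3 : q = ∑ p', ∑ l', d p' l' * Complex.normSq ((B p' * X) l' l) := by
    rw [← Complex.ofReal_inj, ← h1, ← h, Finset.mul_sum, Finset.sum_mul, Matrix.sum_apply]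
    push_cast
    refine Finset.sum_congr rfl fun p' _ => ?_
    have := conjTranspose_mul_diagonal_mul_apply_self (B p' * X) (d p') l
    push_cast at this
    rw [← this, conjTranspose_mul (B p') X]
    simp only [Matrix.mul_assoc]
  have hnn : ∀ p' l', 0 ≤ d p' l' * Complex.normSq ((B p' * X) l' l) := fun p' l' =>
    mul_nonneg (hd p' l') (Complex.normSq_nonneg _)
  have h4 : d p l * (q * q) ≤ q := by
    have e1 := Finset.single_le_sum (f := fun l' => d p l' * Complex.normSq ((B p * X) l' l))
      (fun l' _ => hnn p l') (Finset.mem_univ l)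
    have e2 := Finset.single_le_sum
      (f := fun p' => ∑ l', d p' l' * Complex.normSq ((B p' * X) l' l))
      (fun p' _ => Finset.sum_nonneg fun l' _ => hnn p' l') (Finset.mem_univ p)
    rw [h2, Complex.normSq_ofReal] at e1
    exact (e1.trans e2).trans_eq h3.symm
  have hq0 : 0 ≤ q := (mul_nonneg (hd p l) (mul_self_nonneg q)).trans h4
  rcases hq0.eq_or_lt with hq0 | hq0
  · simp [← hq0]
  · exact le_of_mul_le_mul_right (by linarith) hq0

end MatFn

/-- Corollary 3.2 (Ky Fan form): for a non-negative convex function `g` on `[0,∞)` with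
`g(0) = 0`, positive semidefinite `Aᵢ` and expansive `Zᵢ`, the sum of the `k` largest
eigenvalues of `∑ Zᵢ* g(Aᵢ) Zᵢ` is at most the sum of the `k` largest eigenvalues of
`g(∑ Zᵢ* Aᵢ Zᵢ)`. -/
theorem kyFan_convex_sum_congruence {n m : ℕ} (g : ℝ → ℝ)
    (hg : ConvexOn ℝ (Set.Ici 0) g) (hg0 : ∀ x ∈ Set.Ici (0 : ℝ), 0 ≤ g x)
    (hg00 : g 0 = 0)
    (A Z : Fin m → Matrix (Fin n) (Fin n) ℂ)
    (hA : ∀ i, (A i).PosSemidef)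
    (hZ : ∀ i, ((Z i)ᴴ * Z i - 1).PosSemidef)
    (k : ℕ) (hk1 : 1 ≤ k) (hkn : k ≤ n) :
    sumKLargest
      ((isHermitian_sum_conj (fun i => matFn g (A i) (hA i).1) Z
        fun i => matFn_isHermitian g (A i) (hA i).1).eigenvalues) k ≤
    sumKLargest
      ((matFn_isHermitian g _ (isHermitian_sum_conj A Z fun i => (hA i).1)).eigenvalues) k := by
  classical
  have hA' : ∀ p, (A p).IsHermitian := fun p => (hA p).1
  set hT := isHermitian_sum_conj (fun i => matFn g (A i) (hA i).1) Z
    fun i => matFn_isHermitian g (A i) (hA i).1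
  set E := (hT.eigenvectorUnitary : Matrix (Fin n) (Fin n) ℂ) with hEdef
  have hE : Eᴴ * E = 1 := eigenvectorUnitary_conjTranspose_mul_self hT
  set B : Fin m → Matrix (Fin n) (Fin n) ℂ :=
    fun p => ((hA' p).eigenvectorUnitary : Matrix (Fin n) (Fin n) ℂ)ᴴ * (Z p * E) with hB
  have hS : (∑ p, (Z p)ᴴ * A p * Z p).PosSemidef :=
    posSemidef_sum _ fun p _ => (hA p).conjTranspose_mul_mul_same (Z p)
  have hD : ∑ p, (B p)ᴴ * diagonal (fun l => (g ((hA' p).eigenvalues l) : ℂ)) * B p =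
      diagonal fun j => (hT.eigenvalues j : ℂ) := by
    rw [← conjTranspose_eigenvectorUnitary_mul_mul hT, ← hEdef,
      conjTranspose_mul_sum_matFn_mul g A Z hA' E]
  have hM : ∑ p, (B p)ᴴ * diagonal (fun l => ((hA' p).eigenvalues l : ℂ)) * B p =
      Eᴴ * (∑ p, (Z p)ᴴ * A p * Z p) * E := by
    have h := conjTranspose_mul_sum_matFn_mul (fun x => x) A Z hA' E
    simp only [matFn_id] at h
    exact h.symm
  have hdiag : ∀ (f : ℝ → ℝ) (j : Fin n),
      ((∑ p, (B p)ᴴ * diagonal (fun l => (f ((hA' p).eigenvalues l) : ℂ)) * B p) j j).re =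
        ∑ i : Fin m × Fin n,
          f ((hA' i.1).eigenvalues i.2) * Complex.normSq (B i.1 i.2 j) := fun f j => by
    rw [Matrix.sum_apply, Complex.re_sum, Fintype.sum_prod_type]
    refine Finset.sum_congr rfl fun p _ => ?_
    rw [conjTranspose_mul_diagonal_mul_apply_self
      (B p) (fun l => f ((hA' p).eigenvalues l)), Complex.ofReal_re]
  have hexp : ∀ p, ((B p)ᴴ * B p - 1).PosSemidef := fun p => by
    convert (hZ p).conjTranspose_mul_mul_same E using 1
    rw [mul_sub, sub_mul, Matrix.mul_one, hE, hB]
    simp only [conjTranspose_mul, conjTranspose_conjTranspose]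
    rw [Matrix.mul_assoc, ← Matrix.mul_assoc _ _ (Z p * E),
      eigenvectorUnitary_mul_conjTranspose_self, Matrix.one_mul]
    simp only [Matrix.mul_assoc]
  obtain ⟨J, hJ, hmax, hsum⟩ := exists_finset_sum_eq_sumKLargest hT.eigenvalues hkn
  rw [hsum]
  refine le_trans ?_ (sum_apply_diag_le_sumKLargest hg hS hE hJ hk1)
  simp only [← hM, hdiag fun x => x]
  refine hg.sum_le_sum_apply_sum hg0 hg00 J _ (fun i : Fin m × Fin n => (hA' i.1).eigenvalues i.2)
    (fun i j => Complex.normSq (B i.1 i.2 j)) (fun i => (hA i.1).eigenvalues_nonneg i.2)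
    (fun _ _ => Complex.normSq_nonneg _) (fun j => ?_) hmax
    (fun i => one_le_sum_normSq_row (hexp i.1) i.2) fun i => ?_
  · rw [← hdiag g, hD, diagonal_apply_eq, Complex.ofReal_re]
  · exact mul_sum_normSq_div_le_one _ (fun p l => g ((hA' p).eigenvalues l))
      (fun p l => hg0 _ ((hA p).eigenvalues_nonneg l)) B hD i.1 i.2
end

section
/- Let A₁,…,A_m be positive semidefinite n×n complex matrices, let Z₁,…,Z_m be expansive n×n complex matrices (i.e. Zᵢ*Zᵢ ≥ I), and let p > 1 be a real number. Then for every k with 1 ≤ k ≤ n, the sum of the k largest eigenvalues of ∑ᵢ Zᵢ*Aᵢᵖ Zᵢ is at most the sum of the k largest eigenvalues of (∑ᵢ Zᵢ*AᵢZᵢ)ᵖ. -/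
open Matrix ComplexOrder

section CStarAlgebra

variable {𝔸 : Type*} [CStarAlgebra 𝔸] [PartialOrder 𝔸] [StarOrderedRing 𝔸]

theorem CFC.rpow_neg_le_rpow_neg {s : ℝ} (hs : s ∈ Set.Icc (0 : ℝ) 1) {a b : 𝔸}
    (ha : IsStrictlyPositive a) (hab : a ≤ b) : b ^ (-s) ≤ a ^ (-s) := by
  have hb : IsStrictlyPositive b := ha.of_le hab
  rcases eq_or_ne s 0 with rfl | h0
  · simp [CFC.rpow_zero a ha.nonneg, CFC.rpow_zero b hb.nonneg]
  have h : (b ^ s) ^ (-1 : ℝ) ≤ (a ^ s) ^ (-1 : ℝ) :=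
    CStarAlgebra.rpow_neg_one_le_rpow_neg_one (CFC.rpow_le_rpow hs hab)
      (IsStrictlyPositive.rpow a s ha)
  rwa [CFC.rpow_rpow a s (-1) h0 ha, CFC.rpow_rpow b s (-1) h0 hb, mul_neg_one] at h

theorem CFC.unitary_conj_rpow (u : unitary 𝔸) {a : 𝔸} (ha : IsStrictlyPositive a) (s : ℝ) :
    (star (u : 𝔸) * a * u) ^ s = star (u : 𝔸) * a ^ s * u := by
  have hu : IsUnit (u : 𝔸) := (Unitary.toUnits u).isUnit
  have hb : IsStrictlyPositive (star (u : 𝔸) * a * u) := hu.isStrictlyPositive_star_left_conjugate_iff.2 ha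
  have key : ∀ x, Unitary.conjStarAlgAut ℝ 𝔸 (star u) x = star (u : 𝔸) * x * u := by
    intro x; simp [Unitary.conjStarAlgAut_apply]
  rw [CFC.rpow_eq_cfc_real (a := a) ha.nonneg, CFC.rpow_eq_cfc_real hb.nonneg, ← key, ← key]
  refine (StarAlgHomClass.map_cfc (S := ℝ) _ _ a ?_ ?_ ha.isSelfAdjoint ?_).symm
  · exact fun x hx => (Real.continuousAt_rpow_const _ _ (Or.inl (ha.spectrum_pos hx).ne')).continuousWithinAt
  · rw [show (⇑(Unitary.conjStarAlgAut ℝ 𝔸 (star u)) : 𝔸 → 𝔸) = _ from funext key]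
    fun_prop
  · rw [key]; exact hb.isSelfAdjoint

theorem one_le_mul_star_self_of_one_le {z : 𝔸} (hzu : IsUnit z) (hz : 1 ≤ star z * z) :
    1 ≤ z * star z := by
  obtain ⟨u, rfl⟩ := hzu
  have h := star_left_conjugate_le_conjugate
    (CStarAlgebra.inv_le_one (a := star u * u) (by rw [← Units.val_le_val]; simpa using hz)) (star (u : 𝔸))
  simpa [mul_assoc, ← star_mul] using h

/-- With `h` the square root of `z⋆ aᵖ z`, operator monotonicity compares `h t^(1/p-1) h` with
`z⋆ a z` when `z` is expansive and `t` dominates `z⋆ aᵖ z`. -/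
theorem CFC.sqrt_conj_rpow_le {a z t : 𝔸} {p : ℝ} (hp : 1 < p) (ha : IsStrictlyPositive a)
    (hzu : IsUnit z) (hz : 1 ≤ z * star z) (ht : star z * a ^ p * z ≤ t) :
    CFC.sqrt (star z * a ^ p * z) * t ^ (-(1 - p⁻¹)) * CFC.sqrt (star z * a ^ p * z) ≤
      star z * a * z := by
  have hp0 : p ≠ 0 := by positivity
  have hX : IsStrictlyPositive (a ^ p) := IsStrictlyPositive.rpow a p ha
  have hC : IsStrictlyPositive (star z * a ^ p * z) :=
    hzu.isStrictlyPositive_star_left_conjugate_iff.2 hX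
  set C := star z * a ^ p * z with hCdef
  have hh : CFC.sqrt C * CFC.sqrt C = C := CFC.sqrt_mul_sqrt_self C hC.nonneg
  have hhs : star (CFC.sqrt C) = CFC.sqrt C := (CFC.sqrt_nonneg C).isSelfAdjoint
  obtain ⟨h, hhu⟩ := (IsStrictlyPositive.sqrt C hC).isUnit
  rw [← hhu] at hh hhs ⊢
  have hhis : star (↑h⁻¹ : 𝔸) = ↑h⁻¹ := by
    have : star h = h := Units.ext hhs
    rw [← Units.coe_star, star_inv, this]
  set Y := a ^ (p / 2) with hY
  have hYs : star Y = Y := (CFC.rpow_nonneg (a := a)).isSelfAdjoint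
  have hYY : Y * Y = a ^ p := by rw [hY, ← CFC.rpow_add ha.isUnit]; congr 1; ring
  have hYu : IsUnit Y := (IsStrictlyPositive.rpow a _ ha).isUnit
  set W := Y * z * ↑h⁻¹ with hW
  have hsW : star W = ↑h⁻¹ * star z * Y := by simp [hW, hYs, hhis, mul_assoc]
  have hWh : W * h = Y * z := by simp [hW]
  have hhW : h * star W = star z * Y := by simp [hsW, mul_assoc]
  have hWYz : star W * (Y * z) = h := by
    have : star W * (Y * z) = ↑h⁻¹ * C := by rw [hsW, hCdef, ← hYY]; simp only [mul_assoc]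
    rw [this, ← hh]; simp
  have hWW : star W * W = 1 := by
    rw [hW, ← mul_assoc, hWYz]; simp
  have hWu : IsUnit W := (hYu.mul hzu).mul h⁻¹.isUnit
  have hWW' : W * star W = 1 := by
    obtain ⟨w, hw⟩ := hWu
    rw [← hw] at hWW ⊢
    rw [Units.eq_inv_of_mul_eq_one_right hWW]; simp
  have hle : star W * a ^ p * W ≤ t := by
    refine le_trans ?_ ht
    have h1 : a ^ p ≤ Y * (z * star z) * Y := by
      have := star_left_conjugate_le_conjugate hz Y
      rwa [hYs, mul_one, hYY] at this
    refine (star_left_conjugate_le_conjugate h1 W).trans_eq ?_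
    calc star W * (Y * (z * star z) * Y) * W = (star W * (Y * z)) * star (star W * (Y * z)) := by
          simp [hYs, mul_assoc]
      _ = C := by rw [hWYz, hhs, hh]
  have hs : (1 - p⁻¹) ∈ Set.Icc (0 : ℝ) 1 := by
    have := inv_lt_one_of_one_lt₀ hp
    have : 0 < p⁻¹ := by positivity
    constructor <;> linarith
  have h2 := CFC.rpow_neg_le_rpow_neg hs (hWu.isStrictlyPositive_star_left_conjugate_iff.2 hX) hle
  have hWmem : W ∈ unitary 𝔸 := Unitary.mem_iff.2 ⟨hWW, hWW'⟩
  rw [CFC.unitary_conj_rpow ⟨W, hWmem⟩ hX, CFC.rpow_rpow a _ _ hp0 ha] at h2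
  have h3 := star_left_conjugate_le_conjugate h2 (h : 𝔸)
  rw [hhs] at h3
  refine h3.trans_eq ?_
  calc (h : 𝔸) * (star W * a ^ (p * -(1 - p⁻¹)) * W) * h
      = (h * star W) * a ^ (p * -(1 - p⁻¹)) * (W * h) := by simp only [mul_assoc]
    _ = star z * (a ^ (p / 2) * a ^ (p * -(1 - p⁻¹)) * a ^ (p / 2)) * z := by
      rw [hhW, hWh]; simp only [hY, mul_assoc]
    _ = star z * a * z := by
      rw [← CFC.rpow_add ha.isUnit, ← CFC.rpow_add ha.isUnit,
        show p / 2 + p * -(1 - p⁻¹) + p / 2 = 1 by field_simp; ring, CFC.rpow_one a ha.nonneg]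

end CStarAlgebra

section Real

open Finset

/-- Abel summation: a nonincreasing nonnegative weight preserves nonnegativity of partial sums. -/
theorem sum_mul_nonneg_of_partial_sums_nonneg {n : ℕ} {w d : Fin n → ℝ} (hw : Antitone w)
    (hw0 : ∀ j, 0 ≤ w j) (hd : ∀ k ≤ n, 0 ≤ ∑ j : Fin n with j.val < k, d j) (k : ℕ) (hk : k ≤ n) :
    0 ≤ ∑ j : Fin n with j.val < k, w j * d j := by
  have step (k : ℕ) (hk : k < n) (f : Fin n → ℝ) :
      ∑ j : Fin n with j.val < k + 1, f j = f ⟨k, hk⟩ + ∑ j : Fin n with j.val < k, f j := by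
    rw [← sum_insert (by simp)]
    congr 1
    ext j
    simp [Fin.ext_iff]
    omega
  have key : ∀ k (hk : k < n), w ⟨k, hk⟩ * ∑ j : Fin n with j.val < k + 1, d j ≤
      ∑ j : Fin n with j.val < k + 1, w j * d j := by
    intro k
    induction k with
    | zero => intro hk; rw [step 0 hk, step 0 hk]; simp
    | succ k ih =>
      intro hk
      rw [step (k + 1) hk, step (k + 1) hk]
      have h1 := ih (by omega)
      have h2 : w ⟨k + 1, hk⟩ ≤ w ⟨k, by omega⟩ := hw (by simp [Fin.le_def])
      nlinarith [mul_le_mul_of_nonneg_right h2 (hd (k + 1) hk.le)]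
  rcases k with _ | k
  · simp
  · exact (mul_nonneg (hw0 _) (hd _ hk)).trans (key k hk)

theorem Real.rpow_tangent_le {p a b : ℝ} (hp : 1 < p) (ha : 0 ≤ a) (hb : 0 ≤ b) :
    p * a ^ (p - 1) * (b - a) ≤ b ^ p - a ^ p := by
  have hp0 : 0 < p := by linarith
  have hpq : p.HolderConjugate (p / (p - 1)) := Real.HolderConjugate.conjExponent hp
  have h := Real.young_inequality_of_nonneg hb (Real.rpow_nonneg ha (p - 1)) hpq
  have h1 : p - 1 ≠ 0 := by linarith
  rw [← Real.rpow_mul ha, show (p - 1) * (p / (p - 1)) = p by field_simp] at h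
  have h2 : a ^ p = a ^ (p - 1) * a := by
    rw [← Real.rpow_add_one' ha (by linarith)]; simp
  have h3 := mul_le_mul_of_nonneg_left h hp0.le
  have h4 : p * (b ^ p / p + a ^ p / (p / (p - 1))) = b ^ p + (p - 1) * a ^ p := by
    field_simp
  rw [h4] at h3
  rw [h2] at h3 ⊢
  linarith

/-- Weak majorization is preserved by `x ↦ xᵖ` on nonnegative vectors. -/
theorem sum_rpow_le_of_weak_majorization {n : ℕ} {a b : Fin n → ℝ} {p : ℝ} (hp : 1 < p)
    (ha : Antitone a) (ha0 : ∀ j, 0 ≤ a j) (hb0 : ∀ j, 0 ≤ b j)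
    (h : ∀ k ≤ n, ∑ j : Fin n with j.val < k, a j ≤ ∑ j : Fin n with j.val < k, b j)
    (k : ℕ) (hk : k ≤ n) :
    ∑ j : Fin n with j.val < k, a j ^ p ≤ ∑ j : Fin n with j.val < k, b j ^ p := by
  rw [← sub_nonneg, ← sum_sub_distrib]
  refine le_trans ?_ (sum_le_sum fun j _ => Real.rpow_tangent_le hp (ha0 j) (hb0 j))
  refine sum_mul_nonneg_of_partial_sums_nonneg (w := fun j => p * a j ^ (p - 1))
    (fun i j hij => ?_) (fun j => ?_) (fun k hk => ?_) k hk
  · have := ha hij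
    have := ha0 j
    dsimp only
    gcongr
  · have := ha0 j
    positivity
  · rw [sum_sub_distrib]
    exact sub_nonneg.2 (h k hk)

theorem sum_mul_sum_le_of_symmetric {n : ℕ} {w : Fin n → ℝ} (hw : Monotone w)
    {F : Fin n → Fin n → ℝ} (hF : ∀ i j, 0 ≤ F i j) (hsymm : ∀ i j, F i j = F j i) (k : ℕ) :
    ∑ j : Fin n with j.val < k, w j * ∑ l, F j l ≤
      ∑ j : Fin n with j.val < k, ∑ l, F j l * w l := by
  have split (f : Fin n → ℝ) := sum_filter_add_sum_filter_not univ (fun l : Fin n => l.val < k) f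
  simp_rw [mul_sum, ← split, sum_add_distrib]
  refine add_le_add (le_of_eq ?_) (sum_le_sum fun j hj => sum_le_sum fun l hl => ?_)
  · rw [sum_comm]
    exact sum_congr rfl fun j _ => sum_congr rfl fun l _ => by rw [hsymm, mul_comm]
  · simp only [mem_filter, mem_univ, true_and, not_lt] at hj hl
    rw [mul_comm]
    exact mul_le_mul_of_nonneg_left (hw (Fin.le_def.2 (by omega))) (hF j l)

theorem sum_mul_le_sum_initial {n : ℕ} {ν c : Fin n → ℝ} (hν : Antitone ν) (hc0 : ∀ l, 0 ≤ c l)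
    (hc1 : ∀ l, c l ≤ 1) (k : ℕ) (hk : k ≤ n) (hc : ∑ l, c l = k) :
    ∑ l, c l * ν l ≤ ∑ l : Fin n with l.val < k, ν l := by
  rcases k with _ | k
  · have : ∀ l, c l = 0 := by
      simpa [sum_eq_zero_iff_of_nonneg fun l _ => hc0 l] using hc
    simp [this]
  set m : Fin n := ⟨k, hk⟩
  have h1 : ∑ l, ((if l.val < k + 1 then 1 else 0) - c l) = 0 := by
    rw [sum_sub_distrib, hc, sum_boole, Fin.card_filter_val_lt]
    simp [hk]
  have h2 : 0 ≤ ∑ l, ((if l.val < k + 1 then 1 else 0) - c l) * (ν l - ν m) := by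
    refine sum_nonneg fun l _ => ?_
    split_ifs with hl
    · exact mul_nonneg (sub_nonneg.2 (hc1 l)) (sub_nonneg.2 (hν (Fin.le_def.2 (by simp [m]; omega))))
    · have : ν l ≤ ν m := hν (Fin.le_def.2 (by simp [m]; omega))
      nlinarith [hc0 l]
  simp_rw [mul_sub, sum_sub_distrib, ← sum_mul, h1, sub_mul, sum_sub_distrib, ite_mul, one_mul,
    zero_mul, ← sum_filter] at h2
  linarith

end Real

section Matrix

open Finset

variable {n : ℕ}

theorem mul_diagonal_mul_conjTranspose_apply (W : Matrix (Fin n) (Fin n) ℂ) (ν : Fin n → ℝ)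
    (j : Fin n) : (W * diagonal (fun l => (ν l : ℂ)) * Wᴴ) j j =
      ((∑ l, Complex.normSq (W j l) * ν l : ℝ) : ℂ) := by
  rw [Matrix.mul_apply]
  simp only [Matrix.mul_diagonal, conjTranspose_apply]
  push_cast
  refine sum_congr rfl fun l _ => ?_
  rw [Complex.normSq_eq_conj_mul_self, starRingEnd_apply]
  ring

theorem sum_normSq_row {W : Matrix (Fin n) (Fin n) ℂ} (hW : W * Wᴴ = 1) (j : Fin n) :
    ∑ l, Complex.normSq (W j l) = 1 := by
  have h := mul_diagonal_mul_conjTranspose_apply W (fun _ => 1) j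
  simp [hW, -Complex.ofReal_sum] at h
  exact_mod_cast h.symm

/-- One half of Ky Fan's maximum principle. -/
theorem sum_re_diag_le {U V H : Matrix (Fin n) (Fin n) ℂ} (hU : U ∈ unitaryGroup (Fin n) ℂ)
    (hV : V ∈ unitaryGroup (Fin n) ℂ) {ν : Fin n → ℝ} (hν : Antitone ν)
    (hH : H = V * diagonal (fun l => (ν l : ℂ)) * Vᴴ) (k : ℕ) (hk : k ≤ n) :
    ∑ j : Fin n with j.val < k, ((Uᴴ * H * U) j j).re ≤ ∑ j : Fin n with j.val < k, ν j := by
  set W := Uᴴ * V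
  have hU1 : Uᴴ * U = 1 := (Matrix.mem_unitaryGroup_iff').1 hU
  have hV1 : V * Vᴴ = 1 := Matrix.mem_unitaryGroup_iff.1 hV
  have hW : W * Wᴴ = 1 := by
    calc W * Wᴴ = Uᴴ * (V * Vᴴ) * U := by simp [W, Matrix.mul_assoc]
      _ = 1 := by simp [hV1, hU1]
  have hW' : Wᴴ * Wᴴᴴ = 1 := by simpa using mul_eq_one_comm.1 hW
  have hWH : Uᴴ * H * U = W * diagonal (fun l => (ν l : ℂ)) * Wᴴ := by
    simp [hH, W, Matrix.mul_assoc]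
  have hcol (l : Fin n) : ∑ j, Complex.normSq (W j l) = 1 := by
    simpa using sum_normSq_row hW' l
  simp_rw [hWH, mul_diagonal_mul_conjTranspose_apply, Complex.ofReal_re]
  rw [sum_comm]
  simp_rw [← sum_mul]
  refine sum_mul_le_sum_initial hν (fun l => sum_nonneg fun j _ => Complex.normSq_nonneg _)
    (fun l => ?_) k hk ?_
  · rw [← hcol l]
    exact sum_le_sum_of_subset_of_nonneg (filter_subset _ _) fun j _ _ => Complex.normSq_nonneg _
  · rw [sum_comm]
    simp [sum_normSq_row hW, Fin.card_filter_val_lt, hk]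

theorem exists_antitone_diagonalization {H : Matrix (Fin n) (Fin n) ℂ} (hH : H.IsHermitian) :
    ∃ U ∈ unitaryGroup (Fin n) ℂ, ∃ μ : Fin n → ℝ, Antitone μ ∧ (∀ j, μ j ∈ spectrum ℝ H) ∧
      ∀ f : ℝ → ℝ, cfc f H = U * diagonal (fun l => (f (μ l) : ℂ)) * Uᴴ := by
  set σ : Equiv.Perm (Fin n) := Tuple.sort (fun i => -hH.eigenvalues i)
  set E := (hH.eigenvectorUnitary : Matrix (Fin n) (Fin n) ℂ)
  have hE : E * Eᴴ = 1 := Matrix.mem_unitaryGroup_iff.1 hH.eigenvectorUnitary.2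
  refine ⟨E.submatrix id σ, ?_, hH.eigenvalues ∘ σ, ?_, fun j => hH.eigenvalues_mem_spectrum_real _,
    fun f => ?_⟩
  · rw [Matrix.mem_unitaryGroup_iff, star_eq_conjTranspose, conjTranspose_submatrix,
      submatrix_mul_equiv, hE, submatrix_id_id]
  · intro i j hij
    exact neg_le_neg_iff.1 (Tuple.monotone_sort (fun i => -hH.eigenvalues i) hij)
  · rw [hH.cfc_eq, Matrix.IsHermitian.cfc, Unitary.conjStarAlgAut_apply, conjTranspose_submatrix,
      show (diagonal fun l => (f ((hH.eigenvalues ∘ σ) l) : ℂ)) =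
        (diagonal fun l => (f (hH.eigenvalues l) : ℂ)).submatrix σ σ from
        (submatrix_diagonal_equiv (fun l => (f (hH.eigenvalues l) : ℂ)) σ).symm,
      submatrix_mul_equiv, submatrix_mul_equiv]
    rfl

theorem matFn_eq_cfc (f : ℝ → ℝ) {H : Matrix (Fin n) (Fin n) ℂ} (hH : H.IsHermitian) :
    matFn f H hH = cfc f H := by
  rw [hH.cfc_eq, Matrix.IsHermitian.cfc, Unitary.conjStarAlgAut_apply]
  rfl

theorem sumKLargest_eq_of_diagonalization {H U : Matrix (Fin n) (Fin n) ℂ} (hH : H.IsHermitian)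
    (hU : U ∈ unitaryGroup (Fin n) ℂ) {μ : Fin n → ℝ} (hμ : Antitone μ)
    (h : H = U * diagonal (fun l => (μ l : ℂ)) * Uᴴ) (k : ℕ) :
    sumKLargest hH.eigenvalues k = ∑ j : Fin n with j.val < k, μ j := by
  have hroots : H.charpoly.roots = univ.val.map fun l => (μ l : ℂ) := by
    have hU1 : Uᴴ * U = 1 := Matrix.mem_unitaryGroup_iff'.1 hU
    rw [h, charpoly_mul_comm, ← mul_assoc, hU1, one_mul, charpoly_diagonal]
    have := Polynomial.roots_multiset_prod_X_sub_C (univ.val.map fun l => (μ l : ℂ))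
    rwa [Multiset.map_map] at this
  have hperm : (List.ofFn hH.eigenvalues).Perm (List.ofFn μ) := by
    rw [hH.roots_charpoly_eq_eigenvalues, ← Multiset.map_map, ← Function.comp_def Complex.ofReal,
      ← Multiset.map_map] at hroots
    have := Multiset.map_injective Complex.ofReal_injective hroots
    rwa [Fin.univ_val_map, Fin.univ_val_map, Multiset.coe_eq_coe] at this
  have hsort : (List.ofFn hH.eigenvalues).insertionSort (· ≥ ·) = List.ofFn μ :=
    List.Perm.eq_of_pairwise' (List.pairwise_insertionSort _ _)
      (List.pairwise_ofFn.2 fun i j hij => hμ hij.le) ((List.perm_insertionSort _ _).trans hperm)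
  rw [sumKLargest, hsort, List.sum_take_ofFn]

open scoped MatrixOrder Matrix.Norms.L2Operator

theorem re_diag_conj_eq {H U : Matrix (Fin n) (Fin n) ℂ} (hU : U ∈ unitaryGroup (Fin n) ℂ)
    {μ : Fin n → ℝ} (h : H = U * diagonal (fun l => (μ l : ℂ)) * Uᴴ) (j : Fin n) :
    ((Uᴴ * H * U) j j).re = μ j := by
  have hU1 : Uᴴ * U = 1 := Matrix.mem_unitaryGroup_iff'.1 hU
  have h1 : Uᴴ * H * U = diagonal (fun l => (μ l : ℂ)) := by
    calc Uᴴ * H * U = (Uᴴ * U) * diagonal (fun l => (μ l : ℂ)) * (Uᴴ * U) := by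
          rw [h]; simp [Matrix.mul_assoc]
      _ = _ := by simp [hU1]
  simp [h1]

theorem re_diag_le_of_le {G H : Matrix (Fin n) (Fin n) ℂ} (h : G ≤ H)
    (U : Matrix (Fin n) (Fin n) ℂ) (j : Fin n) :
    ((Uᴴ * G * U) j j).re ≤ ((Uᴴ * H * U) j j).re := by
  have h1 := (Matrix.le_iff.1 h).conjTranspose_mul_mul_same U
  have h2 := (Complex.le_def.1 (h1.diag_nonneg (i := j))).1
  simpa [Matrix.mul_sub, Matrix.sub_mul] using h2

theorem sum_rpow_mul_re_diag_le {A Z T U : Matrix (Fin n) (Fin n) ℂ} {p : ℝ} (hp : 1 < p)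
    (hA : IsStrictlyPositive A) (hZ : 1 ≤ Zᴴ * Z) (hT : Zᴴ * A ^ p * Z ≤ T)
    (hU : U ∈ unitaryGroup (Fin n) ℂ) {τ : Fin n → ℝ} (hτ : Antitone τ)
    (hτT : ∀ j, τ j ∈ spectrum ℝ T)
    (hcfc : ∀ f : ℝ → ℝ, cfc f T = U * diagonal (fun l => (f (τ l) : ℂ)) * Uᴴ) (k : ℕ) :
    ∑ j : Fin n with j.val < k, τ j ^ (-(1 - p⁻¹)) * ((Uᴴ * (Zᴴ * A ^ p * Z) * U) j j).re ≤
      ∑ j : Fin n with j.val < k, ((Uᴴ * (Zᴴ * A * Z) * U) j j).re := by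
  have hU1 : U * Uᴴ = 1 := Matrix.mem_unitaryGroup_iff.1 hU
  have hZu : IsUnit Z := by
    have h1 : IsUnit (Zᴴ * Z) := CStarAlgebra.isUnit_of_le 1 hZ isStrictlyPositive_one
    rw [Matrix.isUnit_iff_isUnit_det, det_mul] at h1
    exact (Matrix.isUnit_iff_isUnit_det _).2 (isUnit_of_mul_isUnit_right h1)
  have hZ' : 1 ≤ Z * star Z := one_le_mul_star_self_of_one_le hZu hZ
  have hC : IsStrictlyPositive (Zᴴ * A ^ p * Z) :=
    hZu.isStrictlyPositive_star_left_conjugate_iff.2 (IsStrictlyPositive.rpow A p hA)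
  have hTpos : IsStrictlyPositive T := hC.of_le hT
  have hτ0 : ∀ j, 0 < τ j := fun j => hTpos.spectrum_pos (hτT j)
  have key := CFC.sqrt_conj_rpow_le hp hA hZu hZ' hT
  rw [star_eq_conjTranspose, CFC.rpow_eq_cfc_real hTpos.nonneg, hcfc] at key
  set C := Zᴴ * A ^ p * Z
  have hhh : CFC.sqrt C * CFC.sqrt C = C := CFC.sqrt_mul_sqrt_self C hC.nonneg
  have hhs : (CFC.sqrt C)ᴴ = CFC.sqrt C := (CFC.sqrt_nonneg C).isSelfAdjoint
  set h := CFC.sqrt C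
  set w : Fin n → ℝ := fun j => τ j ^ (-(1 - p⁻¹))
  set K := Uᴴ * h * U with hK
  have hKs : Kᴴ = K := by simp [hK, hhs, Matrix.mul_assoc]
  have hs : 0 ≤ 1 - p⁻¹ := by linarith [inv_lt_one_of_one_lt₀ hp]
  have hw : Monotone w := fun i j hij =>
    Real.rpow_le_rpow_of_nonpos (hτ0 j) (hτ hij) (by linarith)
  have hCdiag (j : Fin n) : ((Uᴴ * C * U) j j).re = ∑ l, Complex.normSq (K j l) := by
    have : Uᴴ * C * U = K * diagonal (fun _ => ((1 : ℝ) : ℂ)) * Kᴴ := by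
      calc Uᴴ * C * U = Uᴴ * h * (U * Uᴴ) * h * U := by
            rw [hU1, ← hhh]; simp only [Matrix.mul_assoc, Matrix.one_mul]
        _ = _ := by rw [hKs]; simp [hK, Matrix.mul_assoc]
    rw [this, mul_diagonal_mul_conjTranspose_apply, Complex.ofReal_re]
    simp
  have hdiag (j : Fin n) : ∑ l, Complex.normSq (K j l) * w l ≤
      ((Uᴴ * (Zᴴ * A * Z) * U) j j).re := by
    have h1 := re_diag_le_of_le key U j
    have h2 : Uᴴ * (h * (U * diagonal (fun l => (w l : ℂ)) * Uᴴ) * h) * U =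
        K * diagonal (fun l => (w l : ℂ)) * Kᴴ := by
      rw [hKs]; simp [hK, Matrix.mul_assoc]
    rwa [h2, mul_diagonal_mul_conjTranspose_apply, Complex.ofReal_re] at h1
  simp_rw [hCdiag]
  refine (sum_mul_sum_le_of_symmetric hw (fun i j => Complex.normSq_nonneg _)
    (fun i j => ?_) k).trans (sum_le_sum fun j _ => hdiag j)
  have hij : star (K i j) = K j i := by rw [← conjTranspose_apply, hKs]
  rw [← hij, Complex.star_def, Complex.normSq_conj]

/-- The eigenvalues of `∑ Zᵢ* Aᵢᵖ Zᵢ` to the power `1/p` are dominated, in partial sums, by a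
diagonal of `∑ Zᵢ* Aᵢ Zᵢ`. -/
theorem sum_rpow_inv_le_sum_re_diag {m : ℕ} {A Z : Fin m → Matrix (Fin n) (Fin n) ℂ}
    {T U : Matrix (Fin n) (Fin n) ℂ} {p : ℝ} (hp : 1 < p)
    (hA : ∀ i, IsStrictlyPositive (A i)) (hZ : ∀ i, 1 ≤ (Z i)ᴴ * Z i)
    (hT : T = ∑ i, (Z i)ᴴ * A i ^ p * Z i)
    (hU : U ∈ unitaryGroup (Fin n) ℂ) {τ : Fin n → ℝ} (hτ : Antitone τ)
    (hτT : ∀ j, τ j ∈ spectrum ℝ T)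
    (hcfc : ∀ f : ℝ → ℝ, cfc f T = U * diagonal (fun l => (f (τ l) : ℂ)) * Uᴴ) (k : ℕ) :
    ∑ j : Fin n with j.val < k, τ j ^ p⁻¹ ≤
      ∑ j : Fin n with j.val < k, ((Uᴴ * (∑ i, (Z i)ᴴ * A i * Z i) * U) j j).re := by
  have hnonneg (i : Fin m) : 0 ≤ (Z i)ᴴ * A i ^ p * Z i :=
    star_left_conjugate_nonneg CFC.rpow_nonneg (Z i)
  have hT0 : 0 ≤ T := hT ▸ sum_nonneg fun i _ => hnonneg i
  have hτ0 (j : Fin n) : 0 ≤ τ j := spectrum_nonneg_of_nonneg hT0 (hτT j)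
  have hp0 : p⁻¹ ≠ 0 := by positivity
  have hdiag (j : Fin n) : τ j = ∑ i, ((Uᴴ * ((Z i)ᴴ * A i ^ p * Z i) * U) j j).re := by
    have h1 := hcfc id
    rw [cfc_id ℝ T hT0.isSelfAdjoint] at h1
    have h2 := re_diag_conj_eq hU h1 j
    rw [hT, Matrix.mul_sum, Matrix.sum_mul, Matrix.sum_apply, Complex.re_sum] at h2
    exact h2.symm
  have hpow (j : Fin n) : τ j ^ p⁻¹ = τ j ^ (-(1 - p⁻¹)) * τ j := by
    rw [← Real.rpow_add_one' (hτ0 j) (by simpa using hp0)]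
    congr 1
    ring
  calc ∑ j : Fin n with j.val < k, τ j ^ p⁻¹
      = ∑ i, ∑ j : Fin n with j.val < k,
          τ j ^ (-(1 - p⁻¹)) * ((Uᴴ * ((Z i)ᴴ * A i ^ p * Z i) * U) j j).re := by
        rw [sum_comm]
        refine sum_congr rfl fun j _ => ?_
        rw [hpow, ← mul_sum, ← hdiag]
    _ ≤ ∑ i, ∑ j : Fin n with j.val < k, ((Uᴴ * ((Z i)ᴴ * A i * Z i) * U) j j).re :=
        sum_le_sum fun i _ => sum_rpow_mul_re_diag_le hp (hA i) (hZ i)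
          (hT ▸ single_le_sum (f := fun i => (Z i)ᴴ * A i ^ p * Z i)
            (fun i _ => hnonneg i) (mem_univ i)) hU hτ hτT hcfc k
    _ = _ := by
        rw [sum_comm]
        refine sum_congr rfl fun j _ => ?_
        rw [Matrix.mul_sum, Matrix.sum_mul, Matrix.sum_apply, Complex.re_sum]

theorem cfc_rpow_le_add_smul_one_rpow {A : Matrix (Fin n) (Fin n) ℂ} (hA : 0 ≤ A) {p ε : ℝ}
    (hp : 0 ≤ p) (hε : 0 ≤ ε) : cfc (fun x : ℝ => x ^ p) A ≤ (A + ε • 1) ^ p := by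
  have hA' : IsSelfAdjoint A := hA.isSelfAdjoint
  have h1 : A + ε • 1 = cfc (fun x : ℝ => x + ε) A := by
    rw [cfc_add_const ε (fun x => x) A, cfc_id' ℝ A, Algebra.algebraMap_eq_smul_one]
  have h0 : 0 ≤ A + ε • (1 : Matrix (Fin n) (Fin n) ℂ) :=
    add_nonneg hA (smul_nonneg hε zero_le_one)
  rw [CFC.rpow_eq_cfc_real h0, h1, ← cfc_comp (fun x : ℝ => x ^ p) (fun x => x + ε) A]
  refine cfc_mono fun x hx => ?_
  have : 0 ≤ x := spectrum_nonneg_of_nonneg hA hx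
  exact Real.rpow_le_rpow this (by linarith) hp

/-- Perturbing the `Aᵢ` to positive definite matrices `Aᵢ + ε` costs at most `ε tr(∑ Zᵢ* Zᵢ)` in
each eigenvalue of `∑ Zᵢ* Aᵢ Zᵢ`. -/
theorem sum_re_diag_le_sum_add_rpow {m : ℕ} {A Z : Fin m → Matrix (Fin n) (Fin n) ℂ}
    (hA : ∀ i, 0 ≤ A i) (hZ : ∀ i, 1 ≤ (Z i)ᴴ * Z i) {p : ℝ} (hp : 1 < p)
    {V V₀ : Matrix (Fin n) (Fin n) ℂ} (hV : V ∈ unitaryGroup (Fin n) ℂ)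
    (hV₀ : V₀ ∈ unitaryGroup (Fin n) ℂ) {ν : Fin n → ℝ} (hν : Antitone ν) (hν0 : ∀ j, 0 ≤ ν j)
    (hSV : ∑ i, (Z i)ᴴ * A i * Z i = V * diagonal (fun l => (ν l : ℂ)) * Vᴴ)
    (k : ℕ) (hkn : k ≤ n) {ε : ℝ} (hε : 0 < ε) :
    ∑ j : Fin n with j.val < k,
        ((V₀ᴴ * (∑ i, (Z i)ᴴ * cfc (fun x : ℝ => x ^ p) (A i) * Z i) * V₀) j j).re ≤
      ∑ j : Fin n with j.val < k, (ν j + ε * (∑ i, (Z i)ᴴ * Z i).trace.re) ^ p := by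
  set S := ∑ i, (Z i)ᴴ * A i * Z i with hS
  set c := (∑ i, (Z i)ᴴ * Z i).trace.re
  have hG : (∑ i, (Z i)ᴴ * Z i).PosSemidef :=
    Matrix.posSemidef_sum _ fun i _ => Matrix.posSemidef_conjTranspose_mul_self (Z i)
  have hc : 0 ≤ c := (Complex.le_def.1 hG.trace_nonneg).1
  have hB (i : Fin m) : IsStrictlyPositive (A i + ε • 1) :=
    IsStrictlyPositive.nonneg_add (hA i) (isStrictlyPositive_one.smul hε)
  set T := ∑ i, (Z i)ᴴ * (A i + ε • 1) ^ p * Z i with hT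
  have hT0 : 0 ≤ T := sum_nonneg fun i _ => star_left_conjugate_nonneg CFC.rpow_nonneg (Z i)
  obtain ⟨U, hU, τ, hτ, hτT, hUcfc⟩ := exists_antitone_diagonalization hT0.isSelfAdjoint
  have hτ0 (j : Fin n) : 0 ≤ τ j := spectrum_nonneg_of_nonneg hT0 (hτT j)
  have hTU := hUcfc id
  rw [cfc_id ℝ T hT0.isSelfAdjoint] at hTU
  have hU1 : U * Uᴴ = 1 := Matrix.mem_unitaryGroup_iff.1 hU
  have hCT : ∑ i, (Z i)ᴴ * cfc (fun x : ℝ => x ^ p) (A i) * Z i ≤ T := sum_le_sum fun i _ => by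
    exact star_left_conjugate_le_conjugate
      (cfc_rpow_le_add_smul_one_rpow (hA i) (by linarith) hε.le) (Z i)
  have hmaj (l : ℕ) (hl : l ≤ n) : ∑ j : Fin n with j.val < l, τ j ^ p⁻¹ ≤
      ∑ j : Fin n with j.val < l, (ν j + ε * c) := by
    refine (sum_rpow_inv_le_sum_re_diag hp hB hZ hT hU hτ hτT
      hUcfc l).trans ?_
    have hsplit : ∑ i, (Z i)ᴴ * (A i + ε • 1) * Z i = S + ε • ∑ i, (Z i)ᴴ * Z i := by
      simp [hS, Matrix.mul_add, Matrix.add_mul, sum_add_distrib, smul_sum]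
    have hGdiag (j : Fin n) : ((Uᴴ * (∑ i, (Z i)ᴴ * Z i) * U) j j).re ≤ c := by
      have h1 := hG.conjTranspose_mul_mul_same U
      have h2 : (Uᴴ * (∑ i, (Z i)ᴴ * Z i) * U).trace.re = c := by
        rw [Matrix.trace_mul_comm, ← Matrix.mul_assoc, hU1, Matrix.one_mul]
      rw [← h2, Matrix.trace, Complex.re_sum]
      exact single_le_sum (f := fun j => ((Uᴴ * (∑ i, (Z i)ᴴ * Z i) * U).diag j).re)
        (fun j _ => (Complex.le_def.1 (h1.diag_nonneg (i := j))).1) (mem_univ j)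
    rw [hsplit, sum_add_distrib]
    simp_rw [Matrix.mul_add, Matrix.add_mul, Matrix.add_apply, Complex.add_re]
    rw [sum_add_distrib]
    refine add_le_add (sum_re_diag_le hU hV hν hSV l hl) (sum_le_sum fun j _ => ?_)
    simpa using mul_le_mul_of_nonneg_left (hGdiag j) hε.le
  have hp0 : p ≠ 0 := by positivity
  calc _ ≤ ∑ j : Fin n with j.val < k, ((V₀ᴴ * T * V₀) j j).re :=
        sum_le_sum fun j _ => re_diag_le_of_le hCT V₀ j
    _ ≤ ∑ j : Fin n with j.val < k, τ j := sum_re_diag_le hV₀ hU hτ hTU k hkn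
    _ = ∑ j : Fin n with j.val < k, (τ j ^ p⁻¹) ^ p :=
        sum_congr rfl fun j _ => (Real.rpow_inv_rpow (hτ0 j) hp0).symm
    _ ≤ _ := sum_rpow_le_of_weak_majorization hp
        (fun i j hij => Real.rpow_le_rpow (hτ0 j) (hτ hij) (by positivity))
        (fun j => Real.rpow_nonneg (hτ0 j) _)
        (fun j => add_nonneg (hν0 j) (mul_nonneg hε.le hc)) hmaj k hkn

theorem sumKLargest_cfc_rpow_le {m : ℕ} {A Z : Fin m → Matrix (Fin n) (Fin n) ℂ}
    (hA : ∀ i, 0 ≤ A i) (hZ : ∀ i, 1 ≤ (Z i)ᴴ * Z i) {p : ℝ} (hp : 1 < p)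
    {G H : Matrix (Fin n) (Fin n) ℂ} (hG : G.IsHermitian) (hH : H.IsHermitian)
    (hG_eq : G = ∑ i, (Z i)ᴴ * cfc (fun x : ℝ => x ^ p) (A i) * Z i)
    (hH_eq : H = cfc (fun x : ℝ => x ^ p) (∑ i, (Z i)ᴴ * A i * Z i)) (k : ℕ) (hkn : k ≤ n) :
    sumKLargest hG.eigenvalues k ≤ sumKLargest hH.eigenvalues k := by
  have hS0 : 0 ≤ ∑ i, (Z i)ᴴ * A i * Z i :=
    sum_nonneg fun i _ => star_left_conjugate_nonneg (hA i) (Z i)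
  obtain ⟨V, hV, ν, hν, hνS, hVcfc⟩ := exists_antitone_diagonalization hS0.isSelfAdjoint
  have hν0 (j : Fin n) : 0 ≤ ν j := spectrum_nonneg_of_nonneg hS0 (hνS j)
  have hSV := hVcfc id
  rw [cfc_id ℝ _ hS0.isSelfAdjoint] at hSV
  obtain ⟨V₀, hV₀, ν₀, hν₀, -, hV₀cfc⟩ := exists_antitone_diagonalization hG
  have hGV := hV₀cfc id
  rw [cfc_id ℝ G hG.isSelfAdjoint] at hGV
  rw [sumKLargest_eq_of_diagonalization hG hV₀ hν₀ hGV,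
    sumKLargest_eq_of_diagonalization hH hV (μ := fun j => ν j ^ p)
      (fun i j hij => Real.rpow_le_rpow (hν0 j) (hν hij) (by linarith))
      (hH_eq.trans (hVcfc _))]
  have hcont : Continuous fun ε : ℝ => ∑ j : Fin n with j.val < k,
      (ν j + ε * (∑ i, (Z i)ᴴ * Z i).trace.re) ^ p :=
    continuous_finsetSum _ fun j _ =>
      (Real.continuous_rpow_const (by linarith)).comp (by fun_prop)
  have hlim := (hcont.tendsto 0).mono_left (nhdsWithin_le_nhds (s := Set.Ioi (0 : ℝ)))
  simp only [zero_mul, add_zero] at hlim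
  refine ge_of_tendsto hlim (Filter.eventually_of_mem self_mem_nhdsWithin fun ε hε => ?_)
  have hle := sum_re_diag_le_sum_add_rpow hA hZ hp hV hV₀ hν hν0 hSV k hkn hε
  rw [← hG_eq] at hle
  exact (sum_le_sum fun j _ => (re_diag_conj_eq hV₀ hGV j).ge).trans hle

end Matrix

/-- Theorem 1.1 (Ky Fan form): for positive semidefinite `Aᵢ`, expansive `Zᵢ` and `p > 1`,
the sum of the `k` largest eigenvalues of `∑ Zᵢ* Aᵢ^p Zᵢ` is at most the sum of the `k`
largest eigenvalues of `(∑ Zᵢ* Aᵢ Zᵢ)^p`. -/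
theorem kyFan_rpow_sum_congruence {n m : ℕ} (A Z : Fin m → Matrix (Fin n) (Fin n) ℂ)
    (hA : ∀ i, (A i).PosSemidef)
    (hZ : ∀ i, ((Z i)ᴴ * Z i - 1).PosSemidef)
    (p : ℝ) (hp : 1 < p)
    (k : ℕ) (hk1 : 1 ≤ k) (hkn : k ≤ n) :
    sumKLargest
      ((isHermitian_sum_conj (fun i => matFn (fun x => x ^ p) (A i) (hA i).1) Z
        fun i => matFn_isHermitian (fun x => x ^ p) (A i) (hA i).1).eigenvalues) k ≤
    sumKLargest
      ((matFn_isHermitian (fun x => x ^ p) _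
        (isHermitian_sum_conj A Z fun i => (hA i).1)).eigenvalues) k := by
  refine sumKLargest_cfc_rpow_le (fun i => Matrix.nonneg_iff_posSemidef.2 (hA i))
    (fun i => Matrix.le_iff.2 (hZ i)) hp _ _ ?_ (matFn_eq_cfc _ _) k hkn
  simp only [matFn_eq_cfc]
end

section
/- Let f : [0,∞) → [0,∞) be a concave function, let A be a positive semidefinite n×n complex matrix, and let Z be an expansive n×n complex matrix (i.e. Z*Z ≥ I). Then for every k with 1 ≤ k ≤ n, the sum of the k largest eigenvalues of f(Z*AZ) is at most the sum of the k largest eigenvalues of Z*f(A)Z. -/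
open Matrix ComplexOrder

section SortedSums

variable {n : ℕ}

theorem sumKLargest_eq_of_antitone (μ ν : Fin n → ℝ) (hν : Antitone ν)
    (h : Multiset.map μ Finset.univ.val = Multiset.map ν Finset.univ.val) (k : ℕ) :
    sumKLargest μ k = ∑ j with j.val < k, ν j := by
  rw [Fin.univ_val_map, Fin.univ_val_map, Multiset.coe_eq_coe] at h
  have hs : (List.ofFn μ).insertionSort (· ≥ ·) = List.ofFn ν :=
    ((List.perm_insertionSort _ _).trans h).eq_of_pairwise'
      (List.pairwise_insertionSort _ _) hν.sortedGE_ofFn.pairwise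
  rw [sumKLargest, hs, List.sum_take_ofFn]

theorem sum_lt_succ (x : Fin n → ℝ) {k : ℕ} (hk : k < n) :
    ∑ j with j.val < k + 1, x j = ∑ j with j.val < k, x j + x ⟨k, hk⟩ := by
  have : (Finset.univ.filter fun j : Fin n => j.val < k + 1) =
      insert ⟨k, hk⟩ (Finset.univ.filter fun j : Fin n => j.val < k) := by
    ext j
    simp [Fin.ext_iff]
    omega
  rw [this, Finset.sum_insert (by simp), add_comm]

theorem card_val_lt {k : ℕ} (hk : k ≤ n) :
    (Finset.univ.filter fun j : Fin n => j.val < k).card = k := by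
  rw [Fin.card_filter_val_lt, min_eq_right hk]

/-- A convex-type combination of the values of an antitone sequence with weights in `[0, 1]`
of total mass `m + 1` is at most the sum of the first `m + 1` values. -/
theorem sum_mul_le_sum_first (h r : Fin n → ℝ) (hh : Antitone h) (hr0 : ∀ i, 0 ≤ r i)
    (hr1 : ∀ i, r i ≤ 1) {m : ℕ} (hm : m < n) (hr : ∑ i, r i = m + 1) :
    ∑ i, h i * r i ≤ ∑ i with i.val < m + 1, h i := by
  have hc : ∑ i : Fin n, (if i.val < m + 1 then (1 : ℝ) else 0) = m + 1 := by
    rw [← Finset.sum_filter, Finset.sum_const, card_val_lt hm]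
    simp
  have key : ∑ i, (h i - h ⟨m, hm⟩) * (r i - if i.val < m + 1 then (1 : ℝ) else 0) ≤ 0 := by
    refine Finset.sum_nonpos fun i _ => ?_
    split_ifs with hi
    · exact mul_nonpos_of_nonneg_of_nonpos
        (sub_nonneg.2 (hh (Fin.le_def.2 (Nat.le_of_lt_succ hi)))) (sub_nonpos.2 (hr1 i))
    · exact mul_nonpos_of_nonpos_of_nonneg
        (sub_nonpos.2 (hh (Fin.le_def.2 (by simp; omega)))) (by simpa using hr0 i)
  have expand : ∑ i, (h i - h ⟨m, hm⟩) * (r i - if i.val < m + 1 then (1 : ℝ) else 0) =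
      ∑ i, h i * r i - ∑ i : Fin n, (if i.val < m + 1 then h i else 0) -
        h ⟨m, hm⟩ * (∑ i, r i - ∑ i : Fin n, (if i.val < m + 1 then (1 : ℝ) else 0)) := by
    rw [← Finset.sum_sub_distrib, ← Finset.sum_sub_distrib, Finset.mul_sum,
      ← Finset.sum_sub_distrib]
    refine Finset.sum_congr rfl fun i _ => ?_
    split_ifs <;> ring
  rw [expand, hc, hr] at key
  rw [Finset.sum_filter]
  linarith

/-- Abel summation: antitone nonnegative weights preserve nonnegativity of partial sums. -/
theorem sum_mul_nonneg_of_partial_sums (b d : Fin n → ℝ) (hb : Antitone b) (hb0 : ∀ j, 0 ≤ b j)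
    (hd : ∀ m : Fin n, 0 < b m → 0 ≤ ∑ j with j.val < m.val + 1, d j) {k : ℕ} (hk : k ≤ n) :
    0 ≤ ∑ j with j.val < k, b j * d j := by
  have step : ∀ m (hm : m < n), 0 < b ⟨m, hm⟩ →
      b ⟨m, hm⟩ * ∑ j with j.val < m + 1, d j ≤ ∑ j with j.val < m + 1, b j * d j := by
    intro m
    induction m with
    | zero =>
      intro hm _
      rw [sum_lt_succ _ hm, sum_lt_succ _ hm]
      simp
    | succ m ih =>
      intro hm hpos
      have hm' : m < n := by omega
      have hle : b ⟨m + 1, hm⟩ ≤ b ⟨m, hm'⟩ := hb (Fin.le_def.2 (by simp))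
      have h1 := ih hm' (hpos.trans_le hle)
      have h2 := mul_le_mul_of_nonneg_right hle (hd ⟨m, hm'⟩ (hpos.trans_le hle))
      rw [sum_lt_succ _ hm, sum_lt_succ _ hm, mul_add]
      simp only at h2
      linarith
  induction k with
  | zero => simp
  | succ k ih =>
    have hk' : k < n := hk
    rcases (hb0 ⟨k, hk'⟩).eq_or_lt with h0 | hpos
    · rw [sum_lt_succ _ hk', ← h0]
      simpa using ih hk'.le
    · exact (mul_nonneg hpos.le (hd ⟨k, hk'⟩ hpos)).trans (step k hk' hpos)

end SortedSums

section Concave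

variable {f : ℝ → ℝ}

theorem ConcaveOn.monotoneOn_Ici_of_nonneg (hf : ConcaveOn ℝ (Set.Ici 0) f)
    (hf0 : ∀ x ∈ Set.Ici (0 : ℝ), 0 ≤ f x) : MonotoneOn f (Set.Ici 0) := by
  intro x hx y hy hxy
  by_contra! hlt
  have hxy' : x < y := lt_of_le_of_ne hxy (by rintro rfl; exact lt_irrefl _ hlt)
  have hx0 : 0 ≤ x := hx
  set c := (f x - f y) / (y - x) with hc
  have hcpos : 0 < c := div_pos (sub_pos.2 hlt) (sub_pos.2 hxy')
  have hfy := hf0 y hy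
  set t := (f y + 1) / c with ht
  have htpos : 0 < t := div_pos (by linarith) hcpos
  have hz : y + t ∈ Set.Ici (0 : ℝ) := by
    show 0 ≤ y + t
    linarith
  have hs := hf.slope_anti_adjacent hx hz hxy' (by linarith : y < y + t)
  have e1 : (f y - f x) / (y - x) = -c := by rw [hc, ← neg_div, neg_sub]
  rw [e1, add_sub_cancel_left, div_le_iff₀ htpos] at hs
  have e2 : c * t = f y + 1 := by
    rw [ht]
    field_simp
  have := hf0 _ hz
  linarith

theorem ConcaveOn.sub_zero_div_anti (hf : ConcaveOn ℝ (Set.Ici 0) f) {s t : ℝ} (hs : 0 < s)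
    (hst : s ≤ t) : (f t - f 0) / t ≤ (f s - f 0) / s := by
  have ht := hs.trans_le hst
  have h := hf.2 (Set.mem_Ici.2 ht.le) (Set.mem_Ici.2 (le_refl (0 : ℝ)))
    (div_nonneg hs.le ht.le) (sub_nonneg.2 ((div_le_one ht).2 hst)) (by ring)
  simp only [smul_eq_mul, mul_zero, add_zero, div_mul_cancel₀ _ ht.ne'] at h
  have e : s * ((f t - f 0) / t) = s / t * f t - s / t * f 0 := by ring
  rw [le_div_iff₀ hs, mul_comm, e]
  linarith

end Concave

section Diagonalization

variable {n : ℕ}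

theorem sumKLargest_eigenvalues_eq {M U : Matrix (Fin n) (Fin n) ℂ} {d : Fin n → ℝ}
    (hM : M.IsHermitian) (hU : Uᴴ * U = 1)
    (h : M = U * diagonal (fun i => (d i : ℂ)) * Uᴴ) (hd : Antitone d) (k : ℕ) :
    sumKLargest hM.eigenvalues k = ∑ j with j.val < k, d j := by
  refine sumKLargest_eq_of_antitone _ _ hd ?_ k
  have h1 := hM.roots_charpoly_eq_eigenvalues
  have h2 : M.charpoly.roots = Multiset.map (fun i => (d i : ℂ)) Finset.univ.val := by
    rw [h, charpoly_mul_comm, ← mul_assoc, hU, one_mul, charpoly_diagonal]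
    have h3 := Polynomial.roots_multiset_prod_X_sub_C
      (Multiset.map (fun i => (d i : ℂ)) Finset.univ.val)
    rw [Multiset.map_map] at h3
    exact h3
  rw [h1] at h2
  simpa [Function.comp_def] using congrArg (Multiset.map Complex.re) h2

theorem exists_sorted_diagonalization {A : Matrix (Fin n) (Fin n) ℂ} (hA : A.IsHermitian) :
    ∃ (U : Matrix (Fin n) (Fin n) ℂ) (a : Fin n → ℝ), Antitone a ∧ Uᴴ * U = 1 ∧
      (∀ f : ℝ → ℝ, matFn f A hA = U * diagonal (fun i => (f (a i) : ℂ)) * Uᴴ) ∧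
      A = U * diagonal (fun i => (a i : ℂ)) * Uᴴ ∧ ∀ i, ∃ j, a i = hA.eigenvalues j := by
  let σ : Equiv.Perm (Fin n) := Tuple.sort fun i => -hA.eigenvalues i
  let E : Matrix (Fin n) (Fin n) ℂ := hA.eigenvectorUnitary
  have hE : Eᴴ * E = 1 := (Unitary.mem_iff.1 hA.eigenvectorUnitary.2).1
  have hf : ∀ f : ℝ → ℝ, matFn f A hA = E.submatrix id σ *
      diagonal (fun i => (f (hA.eigenvalues (σ i)) : ℂ)) * (E.submatrix id σ)ᴴ := by
    intro f
    ext i j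
    rw [matFn, Matrix.mul_apply, Matrix.mul_apply]
    simp only [Matrix.mul_diagonal, conjTranspose_apply, submatrix_apply, id]
    exact (Equiv.sum_comp σ fun x => E i x * (f (hA.eigenvalues x) : ℂ) * star (E j x)).symm
  refine ⟨E.submatrix id σ, fun i => hA.eigenvalues (σ i), fun i j hij => ?_, ?_, hf, ?_,
    fun i => ⟨_, rfl⟩⟩
  · simpa using Tuple.monotone_sort (fun i => -hA.eigenvalues i) hij
  · have h := submatrix_mul_equiv Eᴴ E σ (Equiv.refl _) σ
    rw [hE, submatrix_one_equiv] at h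
    exact h
  · refine Eq.trans ?_ (hf id)
    conv_lhs => rw [hA.spectral_theorem]
    rfl

theorem conj_diagonal_apply_self (V : Matrix (Fin n) (Fin n) ℂ) (d : Fin n → ℝ) (j : Fin n) :
    (Vᴴ * diagonal (fun i => (d i : ℂ)) * V) j j =
      ((∑ i, d i * Complex.normSq (V i j) : ℝ) : ℂ) := by
  simp only [Matrix.mul_apply (M := Vᴴ * _), Matrix.mul_diagonal, conjTranspose_apply,
    Complex.ofReal_sum, Complex.ofReal_mul, Complex.normSq_eq_conj_mul_self]
  exact Finset.sum_congr rfl fun i _ => by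
    simp only [RCLike.star_def]
    ring

theorem quadForm_conj_diagonal (V : Matrix (Fin n) (Fin n) ℂ) (d : Fin n → ℝ) (x : Fin n → ℂ) :
    star x ⬝ᵥ ((Vᴴ * diagonal (fun i => (d i : ℂ)) * V) *ᵥ x) =
      ((∑ i, d i * Complex.normSq ((V *ᵥ x) i) : ℝ) : ℂ) := by
  rw [← mulVec_mulVec, ← mulVec_mulVec, dotProduct_mulVec, vecMul_conjTranspose, star_star]
  simp only [dotProduct, mulVec_diagonal, Pi.star_apply, Complex.ofReal_sum, Complex.ofReal_mul,
    Complex.normSq_eq_conj_mul_self]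
  exact Finset.sum_congr rfl fun i _ => by
    simp only [RCLike.star_def]
    ring

/-- Expansive congruences do not decrease the sorted eigenvalues. -/
theorem eigenvalue_le_of_expansive (V : Matrix (Fin n) (Fin n) ℂ) {a b : Fin n → ℝ}
    (ha : Antitone a) (hb : Antitone b) (ha0 : ∀ i, 0 ≤ a i)
    (hV : Vᴴ * diagonal (fun i => (a i : ℂ)) * V = diagonal fun i => (b i : ℂ))
    (hexp : (Vᴴ * V - 1).PosSemidef) (m : Fin n) : a m ≤ b m := by
  let M : Matrix (Fin n) (Fin n) ℂ := Matrix.of fun i =>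
    if i < m then Pi.single i 1 else if m < i then V i else 0
  have hdet : M.det = 0 := det_eq_zero_of_row_eq_zero m fun j => by simp [M]
  obtain ⟨x, hx0, hx⟩ := exists_mulVec_eq_zero_iff.2 hdet
  have hlow : ∀ i < m, x i = 0 := fun i hi => by
    simpa [M, mulVec, hi] using congrFun hx i
  have hhigh : ∀ i, m < i → (V *ᵥ x) i = 0 := fun i hi => by
    simpa [M, mulVec, hi, hi.not_gt] using congrFun hx i
  have hquad : ∑ i, a i * Complex.normSq ((V *ᵥ x) i) = ∑ i, b i * Complex.normSq (x i) := by
    have h1 := quadForm_conj_diagonal V a x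
    have h2 := quadForm_conj_diagonal 1 b x
    rw [hV] at h1
    simp only [conjTranspose_one, one_mul, mul_one, one_mulVec] at h2
    exact_mod_cast h1.symm.trans h2
  have hnorm : ∑ i, Complex.normSq (x i) ≤ ∑ i, Complex.normSq ((V *ᵥ x) i) := by
    have h := hexp.dotProduct_mulVec_nonneg x
    have h1 := quadForm_conj_diagonal V 1 x
    have h2 := quadForm_conj_diagonal 1 1 x
    simp only [Pi.one_apply, Complex.ofReal_one, diagonal_one, conjTranspose_one, mul_one, one_mul,
      one_mulVec] at h1 h2
    rw [sub_mulVec, dotProduct_sub, h1, one_mulVec, h2, ← Complex.ofReal_sub] at h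
    exact sub_nonneg.1 (Complex.zero_le_real.1 h)
  have hpos : 0 < ∑ i, Complex.normSq (x i) := by
    obtain ⟨i, hi⟩ := Function.ne_iff.1 hx0
    exact Finset.sum_pos' (fun i _ => Complex.normSq_nonneg _)
      ⟨i, Finset.mem_univ _, Complex.normSq_pos.2 hi⟩
  have h1 : a m * ∑ i, Complex.normSq ((V *ᵥ x) i) ≤
      ∑ i, a i * Complex.normSq ((V *ᵥ x) i) := by
    rw [Finset.mul_sum]
    refine Finset.sum_le_sum fun i _ => ?_
    rcases le_or_gt i m with hi | hi
    · exact mul_le_mul_of_nonneg_right (ha hi) (Complex.normSq_nonneg _)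
    · simp [hhigh i hi]
  have h2 : ∑ i, b i * Complex.normSq (x i) ≤ b m * ∑ i, Complex.normSq (x i) := by
    rw [Finset.mul_sum]
    refine Finset.sum_le_sum fun i _ => ?_
    rcases lt_or_ge i m with hi | hi
    · simp [hlow i hi]
    · exact mul_le_mul_of_nonneg_right (hb hi) (Complex.normSq_nonneg _)
  have h3 := mul_le_mul_of_nonneg_left hnorm (ha0 m)
  exact le_of_mul_le_mul_right (by linarith) hpos

/-- Bessel's inequality for the orthogonal columns of `diagonal (√a) * V`. -/
theorem sum_mul_normSq_div_le_one (V : Matrix (Fin n) (Fin n) ℂ) {a b : Fin n → ℝ}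
    (ha0 : ∀ i, 0 ≤ a i) (hb0 : ∀ j, 0 ≤ b j)
    (hV : Vᴴ * diagonal (fun i => (a i : ℂ)) * V = diagonal fun i => (b i : ℂ)) (i : Fin n) :
    ∑ j, a i * Complex.normSq (V i j) / b j ≤ 1 := by
  let S : Matrix (Fin n) (Fin n) ℂ := diagonal fun i => ((√(a i) : ℝ) : ℂ)
  let T : Matrix (Fin n) (Fin n) ℂ := diagonal fun j => (((√(b j))⁻¹ : ℝ) : ℂ)
  have hS : Sᴴ = S := by simp [S, diagonal_conjTranspose, Pi.star_def]
  have hT : Tᴴ = T := by simp [T, diagonal_conjTranspose, Pi.star_def]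
  have hSS : S * S = diagonal fun i => (a i : ℂ) := by
    simp only [S, diagonal_mul_diagonal, ← Complex.ofReal_mul, Real.mul_self_sqrt (ha0 _)]
  have hTbT : T * (T * (diagonal (fun j => (b j : ℂ)) * T)) = T := by
    simp only [T, diagonal_mul_diagonal, ← Complex.ofReal_mul]
    congr 1
    funext j
    congr 1
    rcases (hb0 j).eq_or_lt with h | h
    · simp [← h]
    · have h1 := Real.sqrt_pos.2 h
      field_simp
      rw [Real.sq_sqrt h.le]
  let W := S * V * T
  have hW : W * Wᴴ * W = W := by
    calc W * Wᴴ * W = S * V * (T * (T * (Vᴴ * (S * S) * V * T))) := by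
          simp only [W, conjTranspose_mul, hS, hT, Matrix.mul_assoc]
      _ = W := by rw [hSS, hV, hTbT]
  have hP : W * Wᴴ * (W * Wᴴ)ᴴ = W * Wᴴ := by
    rw [conjTranspose_mul W Wᴴ, conjTranspose_conjTranspose, ← Matrix.mul_assoc, hW]
  have hdiag : ∀ X : Matrix (Fin n) (Fin n) ℂ,
      (X * Xᴴ) i i = ((∑ j, Complex.normSq (X i j) : ℝ) : ℂ) := by
    intro X
    simp only [Matrix.mul_apply, conjTranspose_apply, Complex.ofReal_sum,
      Complex.normSq_eq_conj_mul_self]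
    exact Finset.sum_congr rfl fun j _ => mul_comm _ _
  set r := ∑ j, Complex.normSq (W i j) with hr
  have hr2 : r * r ≤ r := by
    have h1 : ∑ j, Complex.normSq ((W * Wᴴ) i j) = r := by
      have h := (hdiag (W * Wᴴ)).symm.trans ((congrFun (congrFun hP i) i).trans (hdiag W))
      exact_mod_cast h
    have h2 := Finset.single_le_sum (f := fun j => Complex.normSq ((W * Wᴴ) i j))
      (fun j _ => Complex.normSq_nonneg _) (Finset.mem_univ i)
    simp only [h1, hdiag W, Complex.normSq_ofReal] at h2
    exact h2
  have hsum : ∑ j, a i * Complex.normSq (V i j) / b j = r := by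
    refine Finset.sum_congr rfl fun j _ => ?_
    simp only [W, S, T, Matrix.mul_diagonal, Matrix.diagonal_mul, Complex.normSq_mul,
      Complex.normSq_ofReal, Real.mul_self_sqrt (ha0 i), ← mul_inv, Real.mul_self_sqrt (hb0 j)]
    rfl
  rw [hsum]
  nlinarith

/-- The concave expansive trace inequality on the leading eigenvectors, in coordinates where both
`A` and `Z* A Z` are diagonal. -/
theorem sum_concave_le_of_expansive {f : ℝ → ℝ} (hf : ConcaveOn ℝ (Set.Ici 0) f)
    (hf0 : ∀ x ∈ Set.Ici (0 : ℝ), 0 ≤ f x) (V : Matrix (Fin n) (Fin n) ℂ) {a b : Fin n → ℝ}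
    (ha : Antitone a) (hb : Antitone b) (ha0 : ∀ i, 0 ≤ a i)
    (hV : Vᴴ * diagonal (fun i => (a i : ℂ)) * V = diagonal fun i => (b i : ℂ))
    (hexp : (Vᴴ * V - 1).PosSemidef) {k : ℕ} (hk : k ≤ n) :
    ∑ j with j.val < k, f (b j) ≤
      ∑ j with j.val < k, ∑ i, f (a i) * Complex.normSq (V i j) := by
  have hcol : ∀ j, ∑ i, a i * Complex.normSq (V i j) = b j := fun j => by
    have h := conj_diagonal_apply_self V a j
    rw [hV, diagonal_apply_eq] at h
    exact_mod_cast h.symm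
  have hcol1 : ∀ j, 1 ≤ ∑ i, Complex.normSq (V i j) := fun j => by
    have h := hexp.diag_nonneg (i := j)
    have h1 := conj_diagonal_apply_self V 1 j
    simp only [Pi.one_apply, Complex.ofReal_one, diagonal_one, mul_one, one_mul] at h1
    rw [Matrix.sub_apply, h1, one_apply_eq, ← Complex.ofReal_one, ← Complex.ofReal_sub] at h
    exact sub_nonneg.1 (Complex.zero_le_real.1 h)
  have hb0 : ∀ j, 0 ≤ b j := fun j => by
    rw [← hcol j]
    exact Finset.sum_nonneg fun i _ => mul_nonneg (ha0 i) (Complex.normSq_nonneg _)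
  have hab := eigenvalue_le_of_expansive V ha hb ha0 hV hexp
  have hf0le : ∀ t, 0 ≤ t → 0 ≤ f t - f 0 := fun t ht =>
    sub_nonneg.2 (hf.monotoneOn_Ici_of_nonneg hf0 (Set.mem_Ici.2 le_rfl) (Set.mem_Ici.2 ht) ht)
  have hφ : ∀ t, 0 ≤ t → 0 ≤ (f t - f 0) / t := fun t ht => div_nonneg (hf0le t ht) ht
  have hf00 : 0 ≤ f 0 := hf0 0 (Set.mem_Ici.2 le_rfl)
  let K := ∑ i, (f (a i) - f 0) / a i + ∑ i, (f (b i) - f 0) / b i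
  have hKa : ∀ i, (f (a i) - f 0) / a i ≤ K := fun i =>
    (Finset.single_le_sum (f := fun i => (f (a i) - f 0) / a i) (fun j _ => hφ _ (ha0 j))
      (Finset.mem_univ i)).trans
      (le_add_of_nonneg_right (Finset.sum_nonneg fun j _ => hφ _ (hb0 j)))
  have hKb : ∀ i, (f (b i) - f 0) / b i ≤ K := fun i =>
    (Finset.single_le_sum (f := fun i => (f (b i) - f 0) / b i) (fun j _ => hφ _ (hb0 j))
      (Finset.mem_univ i)).trans
      (le_add_of_nonneg_left (Finset.sum_nonneg fun j _ => hφ _ (ha0 j)))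
  -- `G` is `t ↦ (f t - f 0) / t` along `a`, extended monotonically to the zero eigenvalues.
  let G : Fin n → ℝ := fun i => if 0 < a i then (f (a i) - f 0) / a i else K
  have hGmono : Monotone G := fun i j hij => by
    simp only [G]
    split_ifs with hi hj hj
    · exact hf.sub_zero_div_anti hj (ha hij)
    · exact hKa i
    · exact absurd (hj.trans_le (ha hij)) hi
    · exact le_rfl
  have hGb : ∀ i, 0 < b i → (f (b i) - f 0) / b i ≤ G i := fun i _ => by
    simp only [G]
    split_ifs with hi
    · exact hf.sub_zero_div_anti hi (hab i)
    · exact hKb i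
  have hGa : ∀ i, G i * a i = f (a i) - f 0 := fun i => by
    simp only [G]
    split_ifs with hi
    · exact div_mul_cancel₀ _ hi.ne'
    · have : a i = 0 := le_antisymm (not_lt.1 hi) (ha0 i)
      simp [this]
  clear_value G K
  let p : Fin n → Fin n → ℝ := fun i j => a i * Complex.normSq (V i j) / b j
  have hp0 : ∀ i j, 0 ≤ p i j := fun i j =>
    div_nonneg (mul_nonneg (ha0 i) (Complex.normSq_nonneg _)) (hb0 j)
  let d : Fin n → ℝ := fun j => ∑ i, G i * p i j - (f (b j) - f 0) / b j
  have hd : ∀ m : Fin n, 0 < b m → 0 ≤ ∑ j with j.val < m.val + 1, d j := by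
    intro m hm
    have hpos : ∀ j : Fin n, j.val < m.val + 1 → 0 < b j := fun j hj =>
      hm.trans_le (hb (Fin.le_def.2 (Nat.le_of_lt_succ hj)))
    have hmass : ∑ i, ∑ j with j.val < m.val + 1, p i j = (m.val : ℝ) + 1 := by
      rw [Finset.sum_comm, Finset.sum_congr rfl (g := fun _ => (1 : ℝ)), Finset.sum_const,
        card_val_lt m.isLt]
      · simp
      · intro j hj
        simp only [p]
        rw [← Finset.sum_div, hcol, div_self (hpos j (Finset.mem_filter.1 hj).2).ne']
    have hq1 : ∀ i, ∑ j with j.val < m.val + 1, p i j ≤ 1 := fun i =>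
      (Finset.sum_le_sum_of_subset_of_nonneg (Finset.filter_subset _ _)
        fun j _ _ => hp0 i j).trans (sum_mul_normSq_div_le_one V ha0 hb0 hV i)
    have h := sum_mul_le_sum_first (m := m.val) (fun i => -G i)
      (fun i => ∑ j with j.val < m.val + 1, p i j)
      hGmono.neg (fun i => Finset.sum_nonneg fun j _ => hp0 i j) hq1 m.isLt (by exact hmass)
    have h' : ∑ j with j.val < m.val + 1, (f (b j) - f 0) / b j ≤
        ∑ j with j.val < m.val + 1, G j :=
      Finset.sum_le_sum fun j hj => hGb j (hpos j (Finset.mem_filter.1 hj).2)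
    have hswap : ∑ j with j.val < m.val + 1, ∑ i, G i * p i j =
        ∑ i, G i * ∑ j with j.val < m.val + 1, p i j := by
      rw [Finset.sum_comm]
      simp only [Finset.mul_sum]
    simp only [neg_mul, Finset.sum_neg_distrib] at h
    simp only [d, Finset.sum_sub_distrib, hswap]
    linarith
  have hmain := sum_mul_nonneg_of_partial_sums b d hb hb0 hd hk
  rw [← sub_nonneg, ← Finset.sum_sub_distrib]
  refine hmain.trans (Finset.sum_le_sum fun j _ => ?_)
  have hsplit : ∑ i, f (a i) * Complex.normSq (V i j) =
      ∑ i, (f (a i) - f 0) * Complex.normSq (V i j) + f 0 * ∑ i, Complex.normSq (V i j) := by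
    rw [Finset.mul_sum, ← Finset.sum_add_distrib]
    exact Finset.sum_congr rfl fun i _ => by ring
  have h1 := mul_le_mul_of_nonneg_left (hcol1 j) hf00
  rcases (hb0 j).eq_or_lt with h | h
  · have h2 : 0 ≤ ∑ i, (f (a i) - f 0) * Complex.normSq (V i j) :=
      Finset.sum_nonneg fun i _ => mul_nonneg (hf0le _ (ha0 i)) (Complex.normSq_nonneg _)
    rw [← h, zero_mul, hsplit]
    linarith
  · have h2 : b j * d j =
        ∑ i, (f (a i) - f 0) * Complex.normSq (V i j) - (f (b j) - f 0) := by
      simp only [d, p, mul_sub, Finset.mul_sum, mul_div_cancel₀ _ h.ne']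
      congr 1
      refine Finset.sum_congr rfl fun i _ => ?_
      rw [← hGa i]
      field_simp
    rw [h2, hsplit]
    linarith

end Diagonalization


/-- Theorem 2.1 (Ky Fan form): for a non-negative concave function `f` on `[0,∞)`,
a positive semidefinite `A` and an expansive `Z`, the sum of the `k` largest eigenvalues
of `f(Z* A Z)` is at most the sum of the `k` largest eigenvalues of `Z* f(A) Z`. -/
theorem kyFan_concave_expansive_congruence {n : ℕ} (f : ℝ → ℝ)
    (hf : ConcaveOn ℝ (Set.Ici 0) f) (hf0 : ∀ x ∈ Set.Ici (0 : ℝ), 0 ≤ f x)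
    (A Z : Matrix (Fin n) (Fin n) ℂ) (hA : A.PosSemidef)
    (hZ : (Zᴴ * Z - 1).PosSemidef)
    (k : ℕ) (hk1 : 1 ≤ k) (hkn : k ≤ n) :
    sumKLargest
      ((matFn_isHermitian f _ (Matrix.isHermitian_conjTranspose_mul_mul Z hA.1)).eigenvalues) k ≤
    sumKLargest
      ((Matrix.isHermitian_conjTranspose_mul_mul Z
        (matFn_isHermitian f A hA.1)).eigenvalues) k := by
  rcases Nat.exists_eq_add_of_le' hk1 with ⟨m, rfl⟩
  obtain ⟨U, a, ha, hU, hfA, hAU, haev⟩ := exists_sorted_diagonalization hA.1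
  obtain ⟨P, b, hb, hP, hfB, hBP, hbev⟩ :=
    exists_sorted_diagonalization (isHermitian_conjTranspose_mul_mul Z hA.1)
  have hH := isHermitian_conjTranspose_mul_mul Z (matFn_isHermitian f A hA.1)
  obtain ⟨Q, h, hh, hQ, -, hHQ, -⟩ := exists_sorted_diagonalization hH
  have hUU : U * Uᴴ = 1 := mul_eq_one_comm.1 hU
  have hPP : P * Pᴴ = 1 := mul_eq_one_comm.1 hP
  have hQQ : Q * Qᴴ = 1 := mul_eq_one_comm.1 hQ
  have ha0 : ∀ i, 0 ≤ a i := fun i => by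
    obtain ⟨j, hj⟩ := haev i
    exact hj ▸ hA.eigenvalues_nonneg j
  have hb0 : ∀ i, 0 ≤ b i := fun i => by
    obtain ⟨j, hj⟩ := hbev i
    exact hj ▸ (hA.conjTranspose_mul_mul_same Z).eigenvalues_nonneg j
  have hfb : Antitone fun i => f (b i) := fun i j hij =>
    hf.monotoneOn_Ici_of_nonneg hf0 (hb0 j) (hb0 i) (hb hij)
  rw [sumKLargest_eigenvalues_eq _ hP (hfB f) hfb, sumKLargest_eigenvalues_eq _ hQ hHQ hh]
  let V := Uᴴ * Z * P
  have hV : Vᴴ * diagonal (fun i => (a i : ℂ)) * V = diagonal fun i => (b i : ℂ) := by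
    calc _ = Pᴴ * (Zᴴ * (U * diagonal (fun i => (a i : ℂ)) * Uᴴ) * Z) * P := by
          simp only [V, conjTranspose_mul, conjTranspose_conjTranspose, Matrix.mul_assoc]
      _ = Pᴴ * P * diagonal (fun i => (b i : ℂ)) * (Pᴴ * P) := by
          rw [← hAU, hBP]
          simp only [Matrix.mul_assoc]
      _ = _ := by rw [hP, one_mul, mul_one]
  have hexp : (Vᴴ * V - 1).PosSemidef := by
    have h1 := hZ.conjTranspose_mul_mul_same P
    have h2 : Vᴴ * V = Pᴴ * (Zᴴ * Z) * P := by
      calc Vᴴ * V = Pᴴ * (Zᴴ * (U * Uᴴ) * Z) * P := by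
            simp only [V, conjTranspose_mul, conjTranspose_conjTranspose, Matrix.mul_assoc]
        _ = _ := by rw [hUU, mul_one]
    rwa [mul_sub, sub_mul, mul_one, hP, ← h2] at h1
  refine (sum_concave_le_of_expansive hf hf0 V ha hb ha0 hV hexp hkn).trans ?_
  let R := Qᴴ * P
  have hR : Vᴴ * diagonal (fun i => (f (a i) : ℂ)) * V =
      Rᴴ * diagonal (fun i => (h i : ℂ)) * R := by
    calc _ = Pᴴ * (Zᴴ * (U * diagonal (fun i => (f (a i) : ℂ)) * Uᴴ) * Z) * P := by
          simp only [V, conjTranspose_mul, conjTranspose_conjTranspose, Matrix.mul_assoc]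
      _ = Pᴴ * (Q * diagonal (fun i => (h i : ℂ)) * Qᴴ) * P := by rw [← hfA f, hHQ]
      _ = _ := by
          simp only [R, conjTranspose_mul, conjTranspose_conjTranspose, Matrix.mul_assoc]
  have hentry : ∀ j, ∑ i, f (a i) * Complex.normSq (V i j) =
      ∑ i, h i * Complex.normSq (R i j) := fun j => by
    have h1 := conj_diagonal_apply_self V (fun i => f (a i)) j
    rw [hR, conj_diagonal_apply_self R h j] at h1
    exact_mod_cast h1.symm
  have hRR : Rᴴ * diagonal (fun _ => ((1 : ℝ) : ℂ)) * R = diagonal fun _ => ((1 : ℝ) : ℂ) := by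
    simp only [Complex.ofReal_one, diagonal_one, mul_one]
    calc Rᴴ * R = Pᴴ * (Q * Qᴴ) * P := by
          simp only [R, conjTranspose_mul, conjTranspose_conjTranspose, Matrix.mul_assoc]
      _ = 1 := by rw [hQQ, mul_one, hP]
  have hrow : ∀ i, ∑ j, Complex.normSq (R i j) ≤ 1 := fun i => by
    simpa using sum_mul_normSq_div_le_one R (fun _ => zero_le_one) (fun _ => zero_le_one) hRR i
  have hcol : ∀ j, ∑ i, Complex.normSq (R i j) = 1 := fun j => by
    have h1 := conj_diagonal_apply_self R (fun _ => 1) j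
    rw [hRR, diagonal_apply_eq] at h1
    simpa using (Complex.ofReal_injective h1).symm
  simp only [hentry]
  rw [Finset.sum_comm]
  simp only [← Finset.mul_sum]
  refine sum_mul_le_sum_first h _ hh (fun i => Finset.sum_nonneg fun j _ => Complex.normSq_nonneg _)
    (fun i => (Finset.sum_le_sum_of_subset_of_nonneg (Finset.filter_subset _ _)
      fun j _ _ => Complex.normSq_nonneg _).trans (hrow i)) hkn ?_
  rw [Finset.sum_comm]
  simp only [hcol, Finset.sum_const, card_val_lt hkn]
  simp
end

section
/- (Brown–Kosaki trace inequality) Let f : [0,∞) → [0,∞) be a concave function, let A be a positive semidefinite n×n complex matrix, and let Z be a contractive n×n complex matrix (i.e. Z*Z ≤ I). Then Tr f(Z*AZ) ≥ Tr Z*f(A)Z. -/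
open Matrix ComplexOrder

theorem conjTranspose_mul_diagonal_mul_apply_self_s9 {n : ℕ} (W : Matrix (Fin n) (Fin n) ℂ)
    (d : Fin n → ℝ) (j : Fin n) :
    (Wᴴ * Matrix.diagonal (fun i => (d i : ℂ)) * W) j j =
      ((∑ i, Complex.normSq (W i j) * d i : ℝ) : ℂ) := by
  rw [Matrix.mul_apply]
  push_cast
  refine Finset.sum_congr rfl fun i _ => ?_
  rw [Matrix.mul_diagonal, Matrix.conjTranspose_apply, Complex.normSq_eq_conj_mul_self]
  simp only [Complex.star_def]
  ring

theorem eq_mul_diagonal_eigenvalues_mul {n : ℕ} {A : Matrix (Fin n) (Fin n) ℂ}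
    (hA : A.IsHermitian) : A = (hA.eigenvectorUnitary : Matrix (Fin n) (Fin n) ℂ) *
      Matrix.diagonal (fun i => (hA.eigenvalues i : ℂ)) *
      (hA.eigenvectorUnitary : Matrix (Fin n) (Fin n) ℂ)ᴴ := by
  conv_lhs => rw [hA.spectral_theorem]
  simp [Unitary.conjStarAlgAut_apply, Matrix.star_eq_conjTranspose, Function.comp_def]

theorem trace_matFn {n : ℕ} (f : ℝ → ℝ) (A : Matrix (Fin n) (Fin n) ℂ) (hA : A.IsHermitian) :
    (matFn f A hA).trace = ((∑ i, f (hA.eigenvalues i) : ℝ) : ℂ) := by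
  rw [matFn, Matrix.trace_mul_cycle, Unitary.coe_star_mul_self, one_mul,
    Matrix.trace_diagonal]
  push_cast
  rfl

/-- Jensen's inequality for weights of total mass at most one. -/
theorem ConcaveOn.sum_mul_le_map_of_sum_le_one {ι : Type*} [Fintype ι] {f : ℝ → ℝ}
    (hf : ConcaveOn ℝ (Set.Ici 0) f) (hf0 : 0 ≤ f 0) {w a : ι → ℝ} (hw : ∀ i, 0 ≤ w i)
    (hw1 : ∑ i, w i ≤ 1) (ha : ∀ i, 0 ≤ a i) : ∑ i, w i * f (a i) ≤ f (∑ i, w i * a i) := by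
  have h := hf.le_map_sum (t := Finset.univ)
    (w := fun o : Option ι => o.elim (1 - ∑ i, w i) w) (p := fun o => o.elim 0 a)
    (by rintro (_ | i) _ <;> simp [hw, hw1])
    (by simp [Fintype.sum_option])
    (by rintro (_ | i) _ <;> simp [ha])
  simp only [Fintype.sum_option, Option.elim, smul_eq_mul, mul_zero, zero_add] at h
  have := mul_nonneg (sub_nonneg.2 hw1) hf0
  linarith

/-- Brown–Kosaki trace inequality: for a non-negative concave function `f` on `[0,∞)`,
a positive semidefinite `A` and a contractive `Z` (`Z*Z ≤ I`),
`Tr f(Z* A Z) ≥ Tr Z* f(A) Z`. -/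
theorem brown_kosaki_trace {n : ℕ} (f : ℝ → ℝ)
    (hf : ConcaveOn ℝ (Set.Ici 0) f) (hf0 : ∀ x ∈ Set.Ici (0 : ℝ), 0 ≤ f x)
    (A Z : Matrix (Fin n) (Fin n) ℂ) (hA : A.PosSemidef)
    (hZ : ((1 : Matrix (Fin n) (Fin n) ℂ) - Zᴴ * Z).PosSemidef) :
    (Zᴴ * matFn f A hA.1 * Z).trace ≤
    (matFn f _ (Matrix.isHermitian_conjTranspose_mul_mul Z hA.1)).trace := by
  have hB := Matrix.isHermitian_conjTranspose_mul_mul Z hA.1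
  let U : Matrix (Fin n) (Fin n) ℂ := hA.1.eigenvectorUnitary.1
  let V : Matrix (Fin n) (Fin n) ℂ := hB.eigenvectorUnitary.1
  have hUU : U * Uᴴ = 1 := Unitary.coe_mul_star_self hA.1.eigenvectorUnitary
  have hVV : V * Vᴴ = 1 := Unitary.coe_mul_star_self hB.eigenvectorUnitary
  have hVV' : Vᴴ * V = 1 := Unitary.coe_star_mul_self hB.eigenvectorUnitary
  set W := Uᴴ * Z * V with hW
  have hconj (D : Matrix (Fin n) (Fin n) ℂ) :
      Wᴴ * D * W = Vᴴ * (Zᴴ * (U * D * Uᴴ) * Z) * V := by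
    simp only [hW, Matrix.conjTranspose_mul, Matrix.conjTranspose_conjTranspose, Matrix.mul_assoc]
  have hleft : (Zᴴ * matFn f A hA.1 * Z).trace =
      ((∑ j, ∑ i, Complex.normSq (W i j) * f (hA.1.eigenvalues i) : ℝ) : ℂ) := by
    calc (Zᴴ * matFn f A hA.1 * Z).trace
        = (Wᴴ * Matrix.diagonal (fun i => (f (hA.1.eigenvalues i) : ℂ)) * W).trace := by
          rw [hconj, Matrix.trace_mul_cycle Vᴴ, hVV, one_mul]
          rfl
      _ = _ := by
          rw [Matrix.trace, Complex.ofReal_sum]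
          exact Finset.sum_congr rfl fun j _ => conjTranspose_mul_diagonal_mul_apply_self_s9 W _ j
  have hsum (j : Fin n) :
      ∑ i, Complex.normSq (W i j) * hA.1.eigenvalues i = hB.eigenvalues j := by
    have h : Wᴴ * Matrix.diagonal (fun i => (hA.1.eigenvalues i : ℂ)) * W =
        Matrix.diagonal (fun i => (hB.eigenvalues i : ℂ)) := by
      rw [hconj, ← eq_mul_diagonal_eigenvalues_mul hA.1]
      conv_lhs => rw [eq_mul_diagonal_eigenvalues_mul hB]
      change Vᴴ * (V * _ * Vᴴ) * V = _
      rw [Matrix.mul_assoc, Matrix.mul_assoc, hVV', mul_one, ← Matrix.mul_assoc, hVV',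
        one_mul]
    have h' := conjTranspose_mul_diagonal_mul_apply_self_s9 W hA.1.eigenvalues j
    rw [h, Matrix.diagonal_apply_eq] at h'
    exact_mod_cast h'.symm
  have hle (j : Fin n) : ∑ i, Complex.normSq (W i j) ≤ 1 := by
    have h : Vᴴ * (1 - Zᴴ * Z) * V = 1 - Wᴴ * Matrix.diagonal (fun _ => ((1 : ℝ) : ℂ)) * W := by
      rw [hconj, Complex.ofReal_one, Matrix.diagonal_one, mul_one, hUU, mul_one,
        Matrix.mul_sub, Matrix.sub_mul, mul_one, hVV']
    have h' := (hZ.conjTranspose_mul_mul_same V).diag_nonneg (i := j)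
    rw [h, Matrix.sub_apply, Matrix.one_apply_eq,
      conjTranspose_mul_diagonal_mul_apply_self_s9 W (fun _ => 1) j, sub_nonneg] at h'
    simp only [mul_one] at h'
    exact_mod_cast h'
  rw [hleft, trace_matFn, Complex.real_le_real]
  refine Finset.sum_le_sum fun j _ => ?_
  rw [← hsum j]
  exact hf.sum_mul_le_map_of_sum_le_one (hf0 0 Set.self_mem_Ici) (fun i => Complex.normSq_nonneg _)
    (hle j) hA.eigenvalues_nonneg
end

section
/- Let f : [0,∞) → [0,∞) be a concave function, let A be a positive semidefinite n×n complex matrix, and let Zics be a contractive n×n complex matrix (i.e. Z*Z ≤ I). Then there exists a unitary n×n matrix V such that f(Z*AZ) ≥ V (Z*f(A)Z) V* in the Loewner order; equivalently, the eigenvalues of f(Z*AZ) dominate those of Z*f(A)Z. -/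
open Matrix ComplexOrder

/-- A concave function on `[0,∞)` which is non-negative there is monotone there. -/
theorem ConcaveOn.monotoneOn_of_nonneg {f : ℝ → ℝ} (hf : ConcaveOn ℝ (Set.Ici 0) f)
    (hf0 : ∀ x ∈ Set.Ici (0 : ℝ), 0 ≤ f x) : MonotoneOn f (Set.Ici 0) := by
  intro x hx y hy hxy
  by_contra! hlt
  have hs : 0 < f x - f y := sub_pos.mpr hlt
  have hy0 := hf0 y hy
  set t := f y / (f x - f y) + 1 with ht
  have ht0 : 0 < t := by positivity
  have hts : t * (f x - f y) = f y + (f x - f y) := by rw [ht]; field_simp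
  have hz : y + t * (y - x) ∈ Set.Ici (0 : ℝ) :=
    add_nonneg hy (mul_nonneg ht0.le (sub_nonneg.mpr hxy))
  have hJ := hf.2 hx hz (by positivity : 0 ≤ t / (1 + t)) (by positivity : 0 ≤ 1 / (1 + t))
    (by field_simp; ring)
  have hy' : (t / (1 + t)) • x + (1 / (1 + t)) • (y + t * (y - x)) = y := by
    simp only [smul_eq_mul]; field_simp; ring
  rw [hy'] at hJ
  have hz0 := hf0 _ hz
  have h1 : t * f x + f (y + t * (y - x)) ≤ (1 + t) * f y := by
    have := mul_le_mul_of_nonneg_left hJ (by positivity : 0 ≤ 1 + t)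
    simp only [smul_eq_mul] at this
    have heq : (1 + t) * (t / (1 + t) * f x + 1 / (1 + t) * f (y + t * (y - x))) =
        t * f x + f (y + t * (y - x)) := by field_simp
    rwa [heq] at this
  nlinarith

/-- Jensen's inequality for weights of total mass at most one. -/
theorem ConcaveOn.sum_mul_le_map_sum {ι : Type*} {s : Finset ι} {f : ℝ → ℝ}
    (hf : ConcaveOn ℝ (Set.Ici 0) f) (h0 : 0 ≤ f 0) {w a : ι → ℝ}
    (hw : ∀ i ∈ s, 0 ≤ w i) (hw1 : ∑ i ∈ s, w i ≤ 1) (ha : ∀ i ∈ s, 0 ≤ a i) :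
    ∑ i ∈ s, f (a i) * w i ≤ f (∑ i ∈ s, a i * w i) := by
  have h := hf.map_add_sum_le (t := s) (w := w) (p := a) (v := 1 - ∑ i ∈ s, w i) (q := 0)
    hw (by ring) ha (sub_nonneg.mpr hw1) (Set.mem_Ici.mpr le_rfl)
  simp only [smul_eq_mul, mul_zero, zero_add] at h
  have h2 := mul_nonneg (sub_nonneg.mpr hw1) h0
  simp only [mul_comm (w _)] at h
  linarith

namespace Matrix.IsHermitian

variable {n : ℕ} {A B : Matrix (Fin n) (Fin n) ℂ}

/-- The squared modulus of the `j`-th coordinate of `v` in the eigenbasis of `A`. -/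
noncomputable def eigenweight (hA : A.IsHermitian) (v : Fin n → ℂ) (j : Fin n) : ℝ :=
  Complex.normSq (((star hA.eigenvectorUnitary : Matrix (Fin n) (Fin n) ℂ) *ᵥ v) j)

theorem eigenweight_nonneg (hA : A.IsHermitian) (v : Fin n → ℂ) (j : Fin n) :
    0 ≤ hA.eigenweight v j :=
  Complex.normSq_nonneg _

theorem matFn_id (hA : A.IsHermitian) : matFn (fun x => x) A hA = A := by
  conv_rhs => rw [hA.spectral_theorem]
  rfl

theorem matFn_one (hA : A.IsHermitian) : matFn (fun _ => 1) A hA = 1 := by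
  simp [matFn]

theorem star_dotProduct_matFn_mulVec (hA : A.IsHermitian) (f : ℝ → ℝ) (v : Fin n → ℂ) :
    star v ⬝ᵥ (matFn f A hA *ᵥ v) =
      ((∑ j, f (hA.eigenvalues j) * hA.eigenweight v j : ℝ) : ℂ) := by
  have h : star v ᵥ* (hA.eigenvectorUnitary : Matrix (Fin n) (Fin n) ℂ) =
      star ((star hA.eigenvectorUnitary : Matrix (Fin n) (Fin n) ℂ) *ᵥ v) := by
    rw [star_mulVec, star_eq_conjTranspose, conjTranspose_conjTranspose]
  rw [matFn, ← mulVec_mulVec, ← mulVec_mulVec, dotProduct_mulVec, h]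
  simp only [dotProduct, mulVec_diagonal, Pi.star_apply, eigenweight]
  push_cast
  refine Finset.sum_congr rfl fun j _ => ?_
  rw [Complex.normSq_eq_conj_mul_self, Complex.star_def]
  ring

theorem star_dotProduct_mulVec_eq_sum (hA : A.IsHermitian) (v : Fin n → ℂ) :
    star v ⬝ᵥ (A *ᵥ v) = ((∑ j, hA.eigenvalues j * hA.eigenweight v j : ℝ) : ℂ) := by
  simpa only [hA.matFn_id] using hA.star_dotProduct_matFn_mulVec (fun x => x) v

theorem star_dotProduct_self_eq_sum (hA : A.IsHermitian) (v : Fin n → ℂ) :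
    star v ⬝ᵥ v = ((∑ j, hA.eigenweight v j : ℝ) : ℂ) := by
  simpa only [hA.matFn_one, one_mulVec, one_mul] using
    hA.star_dotProduct_matFn_mulVec (fun _ => 1) v

/-- There is a unit vector whose `A`-energy is at most the `i`-th eigenvalue of `A`, and whose
`B`-energy is at least the `i`-th eigenvalue of `B`. -/
theorem exists_unit_energy_le_and_le (hA : A.IsHermitian) (hB : B.IsHermitian) (i : Fin n) :
    ∃ v : Fin n → ℂ, star v ⬝ᵥ v = 1 ∧
      ∑ j, hA.eigenvalues j * hA.eigenweight v j ≤ hA.eigenvalues i ∧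
      hB.eigenvalues i ≤ ∑ j, hB.eigenvalues j * hB.eigenweight v j := by
  set e : Fin (Fintype.card (Fin n)) ≃ Fin n :=
    Fintype.equivOfCardEq (Fintype.card_fin _)
  let M : Matrix (Fin n) (Fin n) ℂ := fun j =>
    if j = i then 0
    else if e.symm i < e.symm j then
      (star hB.eigenvectorUnitary : Matrix (Fin n) (Fin n) ℂ) j
    else (star hA.eigenvectorUnitary : Matrix (Fin n) (Fin n) ℂ) j
  have hdet : M.det = 0 := det_eq_zero_of_row_eq_zero i fun j => by simp [M]
  obtain ⟨u, hu, hMu⟩ := exists_mulVec_eq_zero_iff.mpr hdet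
  have hpos : 0 < ∑ j, hA.eigenweight u j := by
    have := dotProduct_star_self_pos_iff.mpr hu
    rw [hA.star_dotProduct_self_eq_sum] at this
    exact_mod_cast this
  set N := ∑ j, hA.eigenweight u j with hN
  set c : ℂ := (((√N)⁻¹ : ℝ) : ℂ) with hc
  have hMv : M *ᵥ (c • u) = 0 := by rw [mulVec_smul, hMu, smul_zero]
  have hv1 : star (c • u) ⬝ᵥ (c • u) = 1 := by
    rw [star_smul, smul_dotProduct, dotProduct_smul, hA.star_dotProduct_self_eq_sum, ← hN, hc,
      Complex.star_def, Complex.conj_ofReal, smul_eq_mul, smul_eq_mul]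
    have : (√N)⁻¹ * ((√N)⁻¹ * N) = 1 := by
      rw [← mul_assoc, ← mul_inv, Real.mul_self_sqrt hpos.le, inv_mul_cancel₀ hpos.ne']
    exact_mod_cast this
  generalize c • u = v at hMv hv1
  have hB0 : ∀ j, e.symm i < e.symm j → hB.eigenweight v j = 0 := fun j hj => by
    have hne : j ≠ i := by rintro rfl; exact lt_irrefl _ hj
    have := congrFun hMv j
    simp only [mulVec, M, if_neg hne, if_pos hj] at this
    rw [eigenweight, mulVec, this]
    simp
  have hA0 : ∀ j, e.symm j < e.symm i → hA.eigenweight v j = 0 := fun j hj => by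
    have hne : j ≠ i := by rintro rfl; exact lt_irrefl _ hj
    have := congrFun hMv j
    simp only [mulVec, M, if_neg hne, if_neg hj.not_gt] at this
    rw [eigenweight, mulVec, this]
    simp
  have hA1 : ∑ j, hA.eigenweight v j = 1 := by
    have := hA.star_dotProduct_self_eq_sum v
    rw [hv1] at this
    exact_mod_cast this.symm
  have hB1 : ∑ j, hB.eigenweight v j = 1 := by
    have := hB.star_dotProduct_self_eq_sum v
    rw [hv1] at this
    exact_mod_cast this.symm
  refine ⟨v, hv1, ?_, ?_⟩
  · rw [← mul_one (hA.eigenvalues i), ← hA1, Finset.mul_sum]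
    refine Finset.sum_le_sum fun j _ => ?_
    rcases lt_or_ge (e.symm j) (e.symm i) with h | h
    · simp [hA0 j h]
    · exact mul_le_mul_of_nonneg_right (hA.eigenvalues₀_antitone h) (hA.eigenweight_nonneg v j)
  · rw [← mul_one (hB.eigenvalues i), ← hB1, Finset.mul_sum]
    refine Finset.sum_le_sum fun j _ => ?_
    rcases lt_or_ge (e.symm i) (e.symm j) with h | h
    · simp [hB0 j h]
    · exact mul_le_mul_of_nonneg_right (hB.eigenvalues₀_antitone h) (hB.eigenweight_nonneg v j)

/-- If the eigenvalues of `B` are dominated by `f` of those of `A`, then some unitary conjugate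
of `B` is dominated by `f(A)`. -/
theorem exists_unitary_conj_le_matFn (hA : A.IsHermitian) (hB : B.IsHermitian) (f : ℝ → ℝ)
    (h : ∀ i, hB.eigenvalues i ≤ f (hA.eigenvalues i)) :
    ∃ V ∈ unitaryGroup (Fin n) ℂ, (matFn f A hA - V * B * Vᴴ).PosSemidef := by
  refine ⟨(hA.eigenvectorUnitary * star hB.eigenvectorUnitary : unitaryGroup (Fin n) ℂ),
    Subtype.prop _, ?_⟩
  have hD : (diagonal fun i =>
      ((f (hA.eigenvalues i) : ℂ) - (hB.eigenvalues i : ℂ))).PosSemidef :=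
    posSemidef_diagonal_iff.mpr fun i => by
      rw [← Complex.ofReal_sub]
      exact_mod_cast sub_nonneg.mpr (h i)
  have hP := hD.mul_mul_conjTranspose_same (hA.eigenvectorUnitary : Matrix (Fin n) (Fin n) ℂ)
  have hU : (star hB.eigenvectorUnitary : Matrix (Fin n) (Fin n) ℂ) *
      (hB.eigenvectorUnitary : Matrix (Fin n) (Fin n) ℂ) = 1 := by simp
  convert hP using 1
  have hBeq := hB.matFn_id
  rw [← diagonal_sub, mul_sub, sub_mul]
  simp only [matFn, star_eq_conjTranspose, Submonoid.coe_mul, Unitary.coe_star,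
    conjTranspose_mul, conjTranspose_conjTranspose] at hU hBeq ⊢
  congr 1
  have hconj : (hB.eigenvectorUnitary : Matrix (Fin n) (Fin n) ℂ)ᴴ * B *
      (hB.eigenvectorUnitary : Matrix (Fin n) (Fin n) ℂ) =
      diagonal fun i => (hB.eigenvalues i : ℂ) := by
    nth_rw 2 [← hBeq]
    rw [← mul_assoc, ← mul_assoc, hU, one_mul, mul_assoc, hU, mul_one]
  rw [← hconj]
  simp only [mul_assoc]

end Matrix.IsHermitian

/-- For a non-negative concave function `f` on `[0,∞)`, a positive semidefinite `A` and a
contractive `Z` (`Z*Z ≤ I`), there is a unitary `V` with `f(Z* A Z) ≥ V (Z* f(A) Z) V*`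
in the Loewner order. -/
theorem concave_contractive_congruence_unitary {n : ℕ} (f : ℝ → ℝ)
    (hf : ConcaveOn ℝ (Set.Ici 0) f) (hf0 : ∀ x ∈ Set.Ici (0 : ℝ), 0 ≤ f x)
    (A Z : Matrix (Fin n) (Fin n) ℂ) (hA : A.PosSemidef)
    (hZ : ((1 : Matrix (Fin n) (Fin n) ℂ) - Zᴴ * Z).PosSemidef) :
    ∃ V ∈ Matrix.unitaryGroup (Fin n) ℂ,
      (matFn f _ (Matrix.isHermitian_conjTranspose_mul_mul Z hA.1) -
        V * (Zᴴ * matFn f A hA.1 * Z) * Vᴴ).PosSemidef := by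
  have hH := isHermitian_conjTranspose_mul_mul Z hA.1
  have hB := isHermitian_conjTranspose_mul_mul Z (matFn_isHermitian f A hA.1)
  have hC := hA.conjTranspose_mul_mul_same Z
  refine hH.exists_unitary_conj_le_matFn hB f fun i => ?_
  obtain ⟨v, hv, hCv, hBv⟩ := hH.exists_unit_energy_le_and_le hB i
  have energy (X : Matrix (Fin n) (Fin n) ℂ) :
      star v ⬝ᵥ ((Zᴴ * X * Z) *ᵥ v) = star (Z *ᵥ v) ⬝ᵥ (X *ᵥ (Z *ᵥ v)) := by
    rw [star_mulVec, ← dotProduct_mulVec, mulVec_mulVec, mulVec_mulVec, mul_assoc]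
  have hw : ∑ j, hA.1.eigenweight (Z *ᵥ v) j ≤ 1 := by
    have h := hZ.dotProduct_mulVec_nonneg v
    have h1 := energy 1
    rw [mul_one, one_mulVec, hA.1.star_dotProduct_self_eq_sum] at h1
    rw [sub_mulVec, one_mulVec, dotProduct_sub, hv, h1] at h
    exact_mod_cast sub_nonneg.mp h
  have hCe : ∑ j, hH.eigenvalues j * hH.eigenweight v j =
      ∑ j, hA.1.eigenvalues j * hA.1.eigenweight (Z *ᵥ v) j := by
    have h := energy A
    rw [hH.star_dotProduct_mulVec_eq_sum, hA.1.star_dotProduct_mulVec_eq_sum] at h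
    exact_mod_cast h
  have hBe : ∑ j, hB.eigenvalues j * hB.eigenweight v j =
      ∑ j, f (hA.1.eigenvalues j) * hA.1.eigenweight (Z *ᵥ v) j := by
    have h := energy (matFn f A hA.1)
    rw [hB.star_dotProduct_mulVec_eq_sum, hA.1.star_dotProduct_matFn_mulVec] at h
    exact_mod_cast h
  calc hB.eigenvalues i ≤ ∑ j, f (hA.1.eigenvalues j) * hA.1.eigenweight (Z *ᵥ v) j :=
        hBv.trans_eq hBe
    _ ≤ f (∑ j, hA.1.eigenvalues j * hA.1.eigenweight (Z *ᵥ v) j) :=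
        hf.sum_mul_le_map_sum (hf0 0 Set.self_mem_Ici)
          (fun j _ => hA.1.eigenweight_nonneg _ j) hw fun j _ => hA.eigenvalues_nonneg j
    _ ≤ f (hH.eigenvalues i) :=
        hf.monotoneOn_of_nonneg hf0
          (Finset.sum_nonneg fun j _ =>
            mul_nonneg (hA.eigenvalues_nonneg j) (hA.1.eigenweight_nonneg _ j))
          (hC.eigenvalues_nonneg i) (hCe ▸ hCv)
end

section
/- (Hansen's operator inequality) Let f : [0,∞) → [0,∞) be an operator concave function, meaning that for every dimension and all positive semidefinite matrices X, Y and every λ ∈ [0,1], f(λX + (1−λ)Y) ≥ λf(X) + (1−λ)f(Y) in the Loewner order. Let A be a positive semidefinite n×n complex matrix and let Z be a contractive n×n complex matrix (i.e. Z*Z ≤ I). Then f(Z*AZ) ≥ Z*f(A)Z in the Loewner order. -/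
open Matrix ComplexOrder

theorem matFn_mul_of_intertwines {m n : ℕ} (f : ℝ → ℝ) {M : Matrix (Fin m) (Fin m) ℂ}
    {N : Matrix (Fin n) (Fin n) ℂ} (hM : M.IsHermitian) (hN : N.IsHermitian)
    {V : Matrix (Fin m) (Fin n) ℂ} (h : M * V = V * N) :
    matFn f M hM * V = V * matFn f N hN := by
  set U : Matrix (Fin m) (Fin m) ℂ := ↑hM.eigenvectorUnitary
  set W : Matrix (Fin n) (Fin n) ℂ := ↑hN.eigenvectorUnitary
  have hUU : U * star U = 1 := Unitary.coe_mul_star_self _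
  have hUU' : star U * U = 1 := Unitary.coe_star_mul_self _
  have hWW : W * star W = 1 := Unitary.coe_mul_star_self _
  have hWW' : star W * W = 1 := Unitary.coe_star_mul_self _
  have hMs : M = U * diagonal (fun i => (hM.eigenvalues i : ℂ)) * star U := by
    have := hM.spectral_theorem
    rw [Unitary.conjStarAlgAut_apply] at this
    exact this
  have hNs : N = W * diagonal (fun i => (hN.eigenvalues i : ℂ)) * star W := by
    have := hN.spectral_theorem
    rw [Unitary.conjStarAlgAut_apply] at this
    exact this
  have hK : diagonal (fun i => (hM.eigenvalues i : ℂ)) * (star U * V * W) =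
      (star U * V * W) * diagonal (fun i => (hN.eigenvalues i : ℂ)) := by
    calc _ = (star U * U) * diagonal (fun i => (hM.eigenvalues i : ℂ)) * (star U * V * W) := by
          rw [hUU', Matrix.one_mul]
      _ = star U * (U * diagonal (fun i => (hM.eigenvalues i : ℂ)) * star U * V) * W := by
          simp only [Matrix.mul_assoc]
      _ = star U * (V * (W * diagonal (fun i => (hN.eigenvalues i : ℂ)) * star W)) * W := by
          rw [← hMs, ← hNs, h]
      _ = star U * V * W * diagonal (fun i => (hN.eigenvalues i : ℂ)) * (star W * W) := by
          simp only [Matrix.mul_assoc]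
      _ = _ := by rw [hWW', Matrix.mul_one]
  have hfK : diagonal (fun i => (f (hM.eigenvalues i) : ℂ)) * (star U * V * W) =
      (star U * V * W) * diagonal (fun i => (f (hN.eigenvalues i) : ℂ)) := by
    ext i j
    have hij := congrFun (congrFun hK i) j
    rw [diagonal_mul, mul_diagonal, mul_comm] at hij
    rw [diagonal_mul, mul_diagonal, mul_comm]
    rcases eq_or_ne ((star U * V * W) i j) 0 with h0 | h0
    · simp [h0]
    · rw [Complex.ofReal_injective (mul_left_cancel₀ h0 hij)]
  change U * diagonal _ * star U * V = V * (W * diagonal _ * star W)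
  calc _ = U * (diagonal (fun i => (f (hM.eigenvalues i) : ℂ)) * (star U * V * W)) * star W := by
        simp only [Matrix.mul_assoc, hWW, Matrix.mul_one]
    _ = (U * star U) * V * (W * diagonal (fun i => (f (hN.eigenvalues i) : ℂ)) * star W) := by
        rw [hfK]; simp only [Matrix.mul_assoc]
    _ = _ := by rw [hUU, Matrix.one_mul]

theorem matFn_congr {n : ℕ} (f : ℝ → ℝ) {A B : Matrix (Fin n) (Fin n) ℂ} (hA : A.IsHermitian)
    (hB : B.IsHermitian) (h : A = B) : matFn f A hA = matFn f B hB := by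
  subst h
  rfl

theorem matFn_posSemidef {n : ℕ} {f : ℝ → ℝ} (hf0 : ∀ x ∈ Set.Ici (0 : ℝ), 0 ≤ f x)
    {A : Matrix (Fin n) (Fin n) ℂ} (hA : A.PosSemidef) : (matFn f A hA.1).PosSemidef := by
  have h : (diagonal (fun i => (f (hA.1.eigenvalues i) : ℂ))).PosSemidef :=
    PosSemidef.diagonal fun i => by
      simpa using hf0 _ (hA.eigenvalues_nonneg i)
  exact h.mul_mul_conjTranspose_same _

open scoped MatrixOrder Matrix.Norms.L2Operator in
theorem Matrix.PosSemidef.exists_eq_conjTranspose_mul_self {n : ℕ}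
    {A : Matrix (Fin n) (Fin n) ℂ} (hA : A.PosSemidef) :
    ∃ B : Matrix (Fin n) (Fin n) ℂ, A = Bᴴ * B :=
  CStarAlgebra.nonneg_iff_eq_star_mul_self.mp hA.nonneg

theorem exists_orthogonal_isometries (n : ℕ) :
    ∃ E F : Matrix (Fin (n + n)) (Fin n) ℂ, Eᴴ * E = 1 ∧ Fᴴ * F = 1 ∧ Fᴴ * E = 0 := by
  refine ⟨(fromRows 1 0).submatrix finSumFinEquiv.symm id,
    (fromRows 0 1).submatrix finSumFinEquiv.symm id, ?_, ?_, ?_⟩ <;>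
  · rw [conjTranspose_submatrix, submatrix_mul_equiv, conjTranspose_fromRows_eq_fromCols_conjTranspose,
      fromCols_mul_fromRows]
    simp

/-- Hansen's inequality for an isometry `V`, obtained by averaging `A` with its conjugate under the
reflection `2 V Vᴴ - 1`. -/
theorem matFn_conj_isometry_le {m n : ℕ} {f : ℝ → ℝ}
    (hconc : ∀ (d : ℕ) (X Y : Matrix (Fin d) (Fin d) ℂ) (hX : X.PosSemidef)
      (hY : Y.PosSemidef) (c : ℝ), 0 ≤ c → c ≤ 1 →
      ∀ (hXY : (c • X + (1 - c) • Y).IsHermitian),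
        (matFn f _ hXY - (c • matFn f X hX.1 + (1 - c) • matFn f Y hY.1)).PosSemidef)
    {A : Matrix (Fin m) (Fin m) ℂ} (hA : A.PosSemidef) {V : Matrix (Fin m) (Fin n) ℂ}
    (hV : Vᴴ * V = 1) :
    (matFn f _ (isHermitian_conjTranspose_mul_mul V hA.1) -
      Vᴴ * matFn f A hA.1 * V).PosSemidef := by
  set J : Matrix (Fin m) (Fin m) ℂ := (2 : ℝ) • (V * Vᴴ) - 1 with hJ
  have hJV : J * V = V := by
    rw [hJ, Matrix.sub_mul, Matrix.smul_mul, Matrix.mul_assoc, hV, Matrix.mul_one, Matrix.one_mul,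
      two_smul, add_sub_cancel_right]
  have hJs : Jᴴ = J := by
    simp [hJ, conjTranspose_sub, conjTranspose_smul, conjTranspose_mul]
  have hVJ : Vᴴ * J = Vᴴ := by
    have := congrArg conjTranspose hJV
    rwa [conjTranspose_mul, hJs] at this
  have hJJ : J * J = 1 := by
    nth_rewrite 2 [hJ]
    rw [Matrix.mul_sub, Matrix.mul_smul, ← Matrix.mul_assoc, hJV, Matrix.mul_one, hJ]
    abel
  have hY : (J * A * J).PosSemidef := by
    simpa only [hJs] using hA.mul_mul_conjTranspose_same J
  have hM : ((1 / 2 : ℝ) • A + (1 - 1 / 2 : ℝ) • (J * A * J)).IsHermitian :=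
    ((hA.smul (by norm_num : (0 : ℝ) ≤ 1 / 2)).add
      (hY.smul (by norm_num : (0 : ℝ) ≤ 1 - 1 / 2))).1
  have hMV : ((1 / 2 : ℝ) • A + (1 - 1 / 2 : ℝ) • (J * A * J)) * V = V * (Vᴴ * A * V) := by
    rw [Matrix.add_mul, Matrix.smul_mul, Matrix.smul_mul, Matrix.mul_assoc (J * A), hJV, hJ]
    simp only [Matrix.sub_mul, Matrix.smul_mul, Matrix.one_mul, Matrix.mul_assoc]
    module
  have hfM := matFn_mul_of_intertwines f hM (isHermitian_conjTranspose_mul_mul V hA.1) hMV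
  have hfY : matFn f _ hY.1 * J = J * matFn f A hA.1 :=
    matFn_mul_of_intertwines f hY.1 hA.1 (by rw [Matrix.mul_assoc _ J, hJJ, Matrix.mul_one])
  have hfYV : Vᴴ * (matFn f _ hY.1 * V) = Vᴴ * (matFn f A hA.1 * V) := by
    calc _ = Vᴴ * (matFn f _ hY.1 * J * V) := by rw [Matrix.mul_assoc _ J, hJV]
      _ = _ := by rw [hfY, Matrix.mul_assoc J, ← Matrix.mul_assoc Vᴴ, hVJ]
  have key := (hconc m A _ hA hY (1 / 2) (by norm_num) (by norm_num) hM).conjTranspose_mul_mul_same V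
  convert key using 1
  rw [Matrix.mul_assoc Vᴴ (matFn f A hA.1), Matrix.mul_assoc Vᴴ (_ - _), Matrix.sub_mul, Matrix.mul_sub, hfM,
    ← Matrix.mul_assoc Vᴴ V, hV, Matrix.one_mul, Matrix.add_mul, Matrix.mul_add, Matrix.smul_mul,
    Matrix.smul_mul, Matrix.mul_smul, Matrix.mul_smul, hfYV]
  module

/-- Hansen's operator inequality: if `f : [0,∞) → [0,∞)` is operator concave (i.e. for
all dimensions, all positive semidefinite `X`, `Y` and all `λ ∈ [0,1]`,
`f(λX + (1−λ)Y) ≥ λ f(X) + (1−λ) f(Y)` in the Loewner order), then for a positive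
semidefinite `A` and a contractive `Z` (`Z*Z ≤ I`), `f(Z* A Z) ≥ Z* f(A) Z`. -/
theorem hansen_operator_inequality {n : ℕ} (f : ℝ → ℝ)
    (hf0 : ∀ x ∈ Set.Ici (0 : ℝ), 0 ≤ f x)
    (hconc : ∀ (d : ℕ) (X Y : Matrix (Fin d) (Fin d) ℂ) (hX : X.PosSemidef)
      (hY : Y.PosSemidef) (c : ℝ), 0 ≤ c → c ≤ 1 →
      ∀ (hXY : (c • X + (1 - c) • Y).IsHermitian),
        (matFn f _ hXY - (c • matFn f X hX.1 + (1 - c) • matFn f Y hY.1)).PosSemidef)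
    (A Z : Matrix (Fin n) (Fin n) ℂ) (hA : A.PosSemidef)
    (hZ : ((1 : Matrix (Fin n) (Fin n) ℂ) - Zᴴ * Z).PosSemidef) :
    (matFn f _ (Matrix.isHermitian_conjTranspose_mul_mul Z hA.1) -
      Zᴴ * matFn f A hA.1 * Z).PosSemidef := by
  obtain ⟨D, hD⟩ := hZ.exists_eq_conjTranspose_mul_self
  obtain ⟨E, F, hE, hF, hFE⟩ := exists_orthogonal_isometries n
  have hEF : Eᴴ * F = 0 := by
    simpa [conjTranspose_mul] using congrArg conjTranspose hFE
  have hEV : Eᴴ * (E * Z + F * D) = Z := by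
    rw [Matrix.mul_add, ← Matrix.mul_assoc, ← Matrix.mul_assoc, hE, hEF]; simp
  have hFV : Fᴴ * (E * Z + F * D) = D := by
    rw [Matrix.mul_add, ← Matrix.mul_assoc, ← Matrix.mul_assoc, hF, hFE]; simp
  set V : Matrix (Fin (n + n)) (Fin n) ℂ := E * Z + F * D with hVdef
  have hVs : Vᴴ = Zᴴ * Eᴴ + Dᴴ * Fᴴ := by simp [hVdef, conjTranspose_mul]
  have hVE : Vᴴ * E = Zᴴ := by rw [← conjTranspose_inj]; simpa [conjTranspose_mul] using hEV
  have hVF : Vᴴ * F = Dᴴ := by rw [← conjTranspose_inj]; simpa [conjTranspose_mul] using hFV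
  have hV : Vᴴ * V = 1 := by
    rw [hVs, Matrix.add_mul, Matrix.mul_assoc, Matrix.mul_assoc, hEV, hFV, ← hD]
    abel
  have hB : (E * A * Eᴴ).PosSemidef := hA.mul_mul_conjTranspose_same E
  have hfE := matFn_mul_of_intertwines f hB.1 hA.1 (V := E)
    (by rw [Matrix.mul_assoc _ Eᴴ, hE, Matrix.mul_one])
  have hfF := matFn_mul_of_intertwines f hB.1 (PosSemidef.zero (n := Fin n) (R := ℂ)).1 (V := F)
    (by rw [Matrix.mul_assoc _ Eᴴ, hEF, Matrix.mul_zero, Matrix.mul_zero])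
  have hVBV : (Vᴴ * (E * A * Eᴴ) * V) = Zᴴ * A * Z := by
    rw [← Matrix.mul_assoc, ← Matrix.mul_assoc, hVE, Matrix.mul_assoc _ Eᴴ, hEV]
  have hfV : Vᴴ * matFn f _ hB.1 * V = Zᴴ * matFn f A hA.1 * Z +
      Dᴴ * matFn f 0 (PosSemidef.zero (n := Fin n) (R := ℂ)).1 * D := by
    rw [Matrix.mul_assoc, hVdef, Matrix.mul_add, ← Matrix.mul_assoc _ E, ← Matrix.mul_assoc _ F,
      hfE, hfF, ← hVdef, Matrix.mul_add, Matrix.mul_assoc E, Matrix.mul_assoc F,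
      ← Matrix.mul_assoc Vᴴ, ← Matrix.mul_assoc Vᴴ, hVE, hVF, Matrix.mul_assoc, Matrix.mul_assoc]
  have h1 := matFn_conj_isometry_le hconc hB hV
  have h2 :=
    (matFn_posSemidef hf0 (PosSemidef.zero (n := Fin n) (R := ℂ))).conjTranspose_mul_mul_same D
  rw [hfV, matFn_congr f _ (isHermitian_conjTranspose_mul_mul Z hA.1) hVBV] at h1
  convert h1.add h2 using 1
  abel
end
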